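/- arXiv:0806.4561 — 3 statements merged into one kernel-verified Lean document; each statement's English description precedes it below -/
import Mathlib

section
/- With the function g as defined (for fixed α ∈ (0,π/2), s = sin α, c = cos α): (i) for every x = (x₁,x₂) ∈ W(α) with |x₂| ≤ (sc/(1+c²))x₁, one has g(x) ≥ (s/2)‖x‖; (ii) there exists ε > 0 such that ∂₁g(x) ≥ ε for all x ∈ W(α) at which g is differentiable; (iii) there exists C ∈ (0,∞) such that |∂_i∂_j g(x)| ≤ C‖x‖^{−1} for all i,j ∈ {1,2} and all x ≠ 0 at which g is twice differentiable. -/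
noncomputable section

/-- Euclidean norm on `ℝ²` (as ordered pairs). -/
def rnorm (x : ℝ × ℝ) : ℝ := Real.sqrt (x.1 ^ 2 + x.2 ^ 2)

/-- The open wedge `W(α) = {x : x·e₁ > ‖x‖ cos α}`. -/
def WRc (α : ℝ) : Set (ℝ × ℝ) := {x | rnorm x * Real.cos α < x.1}

/-- The intersection of the open half-spaces where `L₁` and `L₂` are positive. -/
def openCone (L₁ L₂ : ℝ × ℝ →L[ℝ] ℝ) : Set (ℝ × ℝ) := {y | 0 < L₁ y ∧ 0 < L₂ y}

theorem isOpen_openCone (L₁ L₂ : ℝ × ℝ →L[ℝ] ℝ) : IsOpen (openCone L₁ L₂) :=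
  (isOpen_lt continuous_const L₁.continuous).inter (isOpen_lt continuous_const L₂.continuous)

theorem convex_openCone (L₁ L₂ : ℝ × ℝ →L[ℝ] ℝ) : Convex ℝ (openCone L₁ L₂) :=
  (convex_halfSpace_gt L₁.isLinear 0).inter (convex_halfSpace_gt L₂.isLinear 0)

theorem mem_closure_openCone {L₁ L₂ : ℝ × ℝ →L[ℝ] ℝ} {p x : ℝ × ℝ} (hp : p ∈ openCone L₁ L₂)
    (h₁ : 0 ≤ L₁ x) (h₂ : 0 ≤ L₂ x) : x ∈ closure (openCone L₁ L₂) := by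
  have ht : Filter.Tendsto (fun t : ℝ => x + t • p) (nhdsWithin 0 (Set.Ioi 0)) (nhds x) := by
    have : Continuous fun t : ℝ => x + t • p := by fun_prop
    simpa using (this.tendsto 0).mono_left nhdsWithin_le_nhds
  refine mem_closure_of_tendsto ht ?_
  filter_upwards [self_mem_nhdsWithin] with t (ht : 0 < t)
  have := mul_pos ht hp.1
  have := mul_pos ht hp.2
  constructor <;> simp only [map_add, map_smul, smul_eq_mul] <;> linarith

theorem uniqueDiffWithinAt_openCone {L₁ L₂ : ℝ × ℝ →L[ℝ] ℝ} {p x : ℝ × ℝ}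
    (hp : p ∈ openCone L₁ L₂) (h₁ : 0 ≤ L₁ x) (h₂ : 0 ≤ L₂ x) :
    UniqueDiffWithinAt ℝ (openCone L₁ L₂) x :=
  uniqueDiffWithinAt_convex (convex_openCone L₁ L₂)
    (by rw [(isOpen_openCone L₁ L₂).interior_eq]; exact ⟨p, hp⟩) (mem_closure_openCone hp h₁ h₂)

section OneSided

variable {E F : Type*} [NormedAddCommGroup E] [NormedSpace ℝ E]
  [NormedAddCommGroup F] [NormedSpace ℝ F]

/-- Two functions agreeing on a set and at a point of unique differentiability have the same
derivative there. -/
theorem fderiv_eq_of_eqOn {U : Set E} {x : E} {g G : E → F} {G' : E →L[ℝ] F}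
    (hU : UniqueDiffWithinAt ℝ U x) (heq : Set.EqOn g G U) (hx : g x = G x)
    (hg : DifferentiableAt ℝ g x) (hG : HasFDerivAt G G' x) : fderiv ℝ g x = G' :=
  hU.eq hg.hasFDerivAt.hasFDerivWithinAt (hG.hasFDerivWithinAt.congr heq hx)

theorem fderiv_fderiv_apply_eq_of_eqOn {U : Set E} {x : E} {g G : E → F} {G' : E → E →L[ℝ] F}
    (hUo : IsOpen U) (hU : UniqueDiffWithinAt ℝ U x) (heq : Set.EqOn g G U) (hx : g x = G x)
    (hg : DifferentiableAt ℝ g x) (hg2 : DifferentiableAt ℝ (fderiv ℝ g) x)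
    (hG : ∀ y ∈ U, HasFDerivAt G (G' y) y) (hGx : HasFDerivAt G (G' x) x)
    {u : E} {H : E →L[ℝ] F} (hH : HasFDerivAt (fun y => G' y u) H x) (v : E) :
    fderiv ℝ (fderiv ℝ g) x v u = H v := by
  have h1 : HasFDerivAt (fun y => fderiv ℝ g y u)
      ((ContinuousLinearMap.apply ℝ F u).comp (fderiv ℝ (fderiv ℝ g) x)) x :=
    (ContinuousLinearMap.apply ℝ F u).hasFDerivAt.comp x hg2.hasFDerivAt
  have h2 : HasFDerivWithinAt (fun y => fderiv ℝ g y u) H U x := by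
    refine hH.hasFDerivWithinAt.congr (fun y hy => ?_) ?_
    · have : g =ᶠ[nhds y] G := heq.eventuallyEq_of_mem (hUo.mem_nhds hy)
      rw [this.fderiv_eq, (hG y hy).fderiv]
    · rw [fderiv_eq_of_eqOn hU heq hx hg hGx]
  have := hU.eq h1.hasFDerivWithinAt h2
  rw [← this]
  rfl

end OneSided

theorem mem_WRc_iff {α : ℝ} (hs : 0 < Real.sin α) (hc : 0 < Real.cos α) (x : ℝ × ℝ) :
    x ∈ WRc α ↔ Real.cos α * |x.2| < Real.sin α * x.1 := by
  have h1 := Real.sin_sq_add_cos_sq α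
  have hr : 0 ≤ rnorm x := Real.sqrt_nonneg _
  have hr2 : rnorm x ^ 2 = x.1 ^ 2 + x.2 ^ 2 := Real.sq_sqrt (by positivity)
  have hkey : (rnorm x * Real.cos α) ^ 2 - x.1 ^ 2 =
      (Real.cos α * |x.2|) ^ 2 - (Real.sin α * x.1) ^ 2 := by
    rw [mul_pow, mul_pow, mul_pow, hr2, sq_abs]
    linear_combination x.1 ^ 2 * h1
  change rnorm x * Real.cos α < x.1 ↔ _
  constructor
  · intro h
    have hx : 0 < x.1 := lt_of_le_of_lt (by positivity) h
    have := pow_lt_pow_left₀ h (by positivity) two_ne_zero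
    exact lt_of_pow_lt_pow_left₀ 2 (by positivity) (by linarith)
  · intro h
    have hx : 0 < x.1 := pos_of_mul_pos_right (lt_of_le_of_lt (by positivity) h) hs.le
    have := pow_lt_pow_left₀ h (by positivity) two_ne_zero
    exact lt_of_pow_lt_pow_left₀ 2 hx.le (by linarith)

/-- The discriminant, up to a factor, of the quadratic equation for the arc level `k`. -/
def arcDisc (s : ℝ) (x : ℝ × ℝ) : ℝ := s ^ 2 * x.1 ^ 2 - (4 - s ^ 2) * x.2 ^ 2

/-- The larger root of the quadratic equation for the arc level `k`. -/
def arcLevel (s : ℝ) (x : ℝ × ℝ) : ℝ := s / (4 - s ^ 2) * (2 * x.1 + √(arcDisc s x))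

/-- The derivative of `arcLevel`. -/
def arcLevelDeriv (s : ℝ) (x : ℝ × ℝ) : ℝ × ℝ →L[ℝ] ℝ :=
  (s / (4 - s ^ 2) * (2 + s ^ 2 * x.1 / √(arcDisc s x))) • ContinuousLinearMap.fst ℝ ℝ ℝ -
    (s * x.2 / √(arcDisc s x)) • ContinuousLinearMap.snd ℝ ℝ ℝ

section Arc

variable {s c : ℝ} {x : ℝ × ℝ}

theorem sq_le_arcDisc (hsc : s ^ 2 + c ^ 2 = 1)
    (hx : |x.2| ≤ s * c / (1 + c ^ 2) * x.1) :
    (s ^ 2 * x.1 / (1 + c ^ 2)) ^ 2 ≤ arcDisc s x := by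
  have h := pow_le_pow_left₀ (abs_nonneg _) hx 2
  rw [sq_abs] at h
  have hs2 : s ^ 2 = 1 - c ^ 2 := by linarith
  have hm : 0 ≤ 4 - s ^ 2 := by nlinarith
  have h2 := mul_le_mul_of_nonneg_left h hm
  have : s ^ 2 * x.1 ^ 2 - (4 - s ^ 2) * (s * c / (1 + c ^ 2) * x.1) ^ 2 =
      (s ^ 2 * x.1 / (1 + c ^ 2)) ^ 2 := by
    rw [mul_pow, div_pow, div_pow, mul_pow, mul_pow, hs2]
    field_simp
    ring
  unfold arcDisc
  linarith

theorem le_sqrt_arcDisc (hsc : s ^ 2 + c ^ 2 = 1)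
    (hx : |x.2| ≤ s * c / (1 + c ^ 2) * x.1) :
    s ^ 2 * x.1 / (1 + c ^ 2) ≤ √(arcDisc s x) :=
  Real.le_sqrt_of_sq_le (sq_le_arcDisc hsc hx)

theorem arcDisc_pos (hsc : s ^ 2 + c ^ 2 = 1) (hs : 0 < s) (hx1 : 0 < x.1)
    (hx : |x.2| ≤ s * c / (1 + c ^ 2) * x.1) : 0 < arcDisc s x :=
  lt_of_lt_of_le (by positivity) (sq_le_arcDisc hsc hx)

theorem eq_arcLevel (hc : 0 < c) (hsc : s ^ 2 + c ^ 2 = 1) (hs : 0 < s) (hx1 : 0 < x.1)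
    (hx : |x.2| ≤ s * c / (1 + c ^ 2) * x.1) {k : ℝ}
    (hk : (2 * k / s - x.1) ^ 2 + x.2 ^ 2 = k ^ 2) (hk' : x.1 ≤ 2 * k / s) :
    k = arcLevel s x := by
  have hm : 0 < 4 - s ^ 2 := by nlinarith
  have hD := le_sqrt_arcDisc hsc hx
  have hD2 := Real.sq_sqrt (arcDisc_pos hsc hs hx1 hx).le
  have hk1 : (2 * k - s * x.1) ^ 2 + s ^ 2 * x.2 ^ 2 = s ^ 2 * k ^ 2 := by
    rw [← hk]; field_simp
  rw [le_div_iff₀ hs] at hk'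
  have hsq : ((4 - s ^ 2) * k - 2 * s * x.1) ^ 2 = (s * √(arcDisc s x)) ^ 2 := by
    rw [mul_pow, hD2, arcDisc]
    linear_combination (4 - s ^ 2) * hk1
  have hlt : s ^ 2 * x.1 / 2 < s ^ 2 * x.1 / (1 + c ^ 2) := by
    apply div_lt_div_of_pos_left <;> first | positivity | nlinarith
  have : (4 - s ^ 2) * k - 2 * s * x.1 = s * √(arcDisc s x) := by
    rcases sq_eq_sq_iff_eq_or_eq_neg.mp hsq with h | h
    · exact h
    · have h1 := mul_lt_mul_of_pos_left (hlt.trans_le hD) hs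
      have h2 := mul_le_mul_of_nonneg_left hk' hm.le
      nlinarith
  rw [arcLevel]
  field_simp
  linarith

theorem half_mul_rnorm_le_of_arc (hc : 0 < c) (hsc : s ^ 2 + c ^ 2 = 1) (hs : 0 < s)
    (hx1 : 0 < x.1) (hx : |x.2| ≤ s * c / (1 + c ^ 2) * x.1) {k : ℝ}
    (hk : (2 * k / s - x.1) ^ 2 + x.2 ^ 2 = k ^ 2) (hk' : x.1 ≤ 2 * k / s) :
    s / 2 * rnorm x ≤ k := by
  have hm : 0 < 4 - s ^ 2 := by nlinarith
  have hk0 : 0 < k := by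
    rw [le_div_iff₀ hs] at hk'
    nlinarith [mul_pos hx1 hs]
  have hD := le_sqrt_arcDisc hsc hx
  have hlow : s * x.1 ≤ (1 + c ^ 2) * k := by
    rw [eq_arcLevel hc hsc hs hx1 hx hk hk', arcLevel]
    rw [div_le_iff₀ (by positivity)] at hD
    rw [← mul_assoc, mul_div_assoc', div_mul_eq_mul_div, le_div_iff₀ hm]
    have := mul_le_mul_of_nonneg_left hD hs.le
    have e : s ^ 2 = 1 - c ^ 2 := by linarith
    rw [e] at this ⊢
    linarith
  have hk1 : (2 * k - s * x.1) ^ 2 + s ^ 2 * x.2 ^ 2 = s ^ 2 * k ^ 2 := by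
    rw [← hk]; field_simp
  refine le_of_sq_le_sq ?_ hk0.le
  rw [mul_pow, rnorm, Real.sq_sqrt (by positivity)]
  have h4 : 4 * (s * x.1) ≤ (8 - s ^ 2) * k := by nlinarith
  nlinarith [mul_le_mul_of_nonneg_right h4 hk0.le]

theorem hasFDerivAt_sqrt_arcDisc (h : 0 < arcDisc s x) :
    HasFDerivAt (fun y => √(arcDisc s y))
      ((s ^ 2 * x.1 / √(arcDisc s x)) • ContinuousLinearMap.fst ℝ ℝ ℝ -
        ((4 - s ^ 2) * x.2 / √(arcDisc s x)) • ContinuousLinearMap.snd ℝ ℝ ℝ) x := by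
  have h1 : HasFDerivAt (fun y : ℝ × ℝ => y.1) (ContinuousLinearMap.fst ℝ ℝ ℝ) x := hasFDerivAt_fst
  have h2 : HasFDerivAt (fun y : ℝ × ℝ => y.2) (ContinuousLinearMap.snd ℝ ℝ ℝ) x := hasFDerivAt_snd
  have hq := ((h1.pow 2).const_mul (s ^ 2)).sub ((h2.pow 2).const_mul (4 - s ^ 2))
  refine (HasFDerivAt.sqrt hq h.ne').congr_fderiv ?_
  have hD := Real.sqrt_pos.mpr h
  have e : √(s ^ 2 * x.1 ^ 2 - (4 - s ^ 2) * x.2 ^ 2) = √(arcDisc s x) := rfl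
  ext <;> simp [e] <;> field_simp

theorem hasFDerivAt_arcLevel (hm : 4 - s ^ 2 ≠ 0) (h : 0 < arcDisc s x) :
    HasFDerivAt (arcLevel s) (arcLevelDeriv s x) x := by
  have h1 : HasFDerivAt (fun y : ℝ × ℝ => y.1) (ContinuousLinearMap.fst ℝ ℝ ℝ) x := hasFDerivAt_fst
  refine (((h1.const_mul 2).add (hasFDerivAt_sqrt_arcDisc h)).const_mul
    (s / (4 - s ^ 2))).congr_fderiv ?_
  have hD := Real.sqrt_pos.mpr h
  ext
  · simp [arcLevelDeriv]
    ring
  · simp [arcLevelDeriv]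
    field_simp

theorem hasFDerivAt_arcLevelDeriv_fst (hm : 4 - s ^ 2 ≠ 0) (h : 0 < arcDisc s x) :
    HasFDerivAt (fun y => arcLevelDeriv s y (1, 0))
      ((-(s ^ 3 * x.2 ^ 2 / √(arcDisc s x) ^ 3)) • ContinuousLinearMap.fst ℝ ℝ ℝ +
        (s ^ 3 * x.1 * x.2 / √(arcDisc s x) ^ 3) • ContinuousLinearMap.snd ℝ ℝ ℝ) x := by
  have h1 : HasFDerivAt (fun y : ℝ × ℝ => y.1) (ContinuousLinearMap.fst ℝ ℝ ℝ) x := hasFDerivAt_fst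
  have hD := Real.sqrt_pos.mpr h
  have hD2 := Real.sq_sqrt h.le
  have hf := ((((h1.const_mul (s ^ 2)).mul
    ((hasDerivAt_inv hD.ne').comp_hasFDerivAt x (hasFDerivAt_sqrt_arcDisc h))).const_add 2).const_mul (s / (4 - s ^ 2)))
  refine (hf.congr_fderiv ?_).congr_of_eventuallyEq (.of_forall fun y => ?_)
  · ext
    · simp
      field_simp
      rw [hD2, arcDisc]
      ring
    · simp
      field_simp
  · simp [arcLevelDeriv, div_eq_mul_inv]

theorem hasFDerivAt_arcLevelDeriv_snd (h : 0 < arcDisc s x) :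
    HasFDerivAt (fun y => arcLevelDeriv s y (0, 1))
      ((s ^ 3 * x.1 * x.2 / √(arcDisc s x) ^ 3) • ContinuousLinearMap.fst ℝ ℝ ℝ +
        (-(s ^ 3 * x.1 ^ 2 / √(arcDisc s x) ^ 3)) • ContinuousLinearMap.snd ℝ ℝ ℝ) x := by
  have h2 : HasFDerivAt (fun y : ℝ × ℝ => y.2) (ContinuousLinearMap.snd ℝ ℝ ℝ) x := hasFDerivAt_snd
  have hD := Real.sqrt_pos.mpr h
  have hD2 := Real.sq_sqrt h.le
  have hf := ((h2.const_mul s).mul ((hasDerivAt_inv hD.ne').comp_hasFDerivAt x (hasFDerivAt_sqrt_arcDisc h))).neg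
  refine (hf.congr_fderiv ?_).congr_of_eventuallyEq (.of_forall fun y => ?_)
  · ext
    · simp
      field_simp
    · simp
      field_simp
      rw [hD2, arcDisc]
      ring
  · simp [arcLevelDeriv, div_eq_mul_inv]

theorem abs_div_sqrt_arcDisc_le (hc : 0 < c) (hsc : s ^ 2 + c ^ 2 = 1) (hs : 0 < s)
    (hx1 : 0 < x.1) (hx : |x.2| ≤ s * c / (1 + c ^ 2) * x.1) {w : ℝ} (hw : |w| ≤ x.1 ^ 2) :
    |s ^ 3 * w / √(arcDisc s x) ^ 3| ≤ 2 * ((1 + c ^ 2) ^ 3 / s ^ 3) / rnorm x := by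
  have hD := le_sqrt_arcDisc hsc hx
  have hD0 : 0 < s ^ 2 * x.1 / (1 + c ^ 2) := by positivity
  have hx2 : |x.2| ≤ x.1 := by
    refine hx.trans (mul_le_of_le_one_left hx1.le ?_)
    rw [div_le_one (by positivity)]
    nlinarith
  have hr : rnorm x ≤ 2 * x.1 := by
    refine Real.sqrt_le_iff.mpr ⟨by positivity, ?_⟩
    nlinarith [sq_le_sq' (abs_le.mp hx2).1 (abs_le.mp hx2).2]
  have hr0 : 0 < rnorm x := Real.sqrt_pos.mpr (by positivity)
  rw [abs_div, abs_mul, abs_of_pos (pow_pos hs 3), abs_of_pos (pow_pos (hD0.trans_le hD) 3)]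
  calc s ^ 3 * |w| / √(arcDisc s x) ^ 3
      ≤ s ^ 3 * x.1 ^ 2 / (s ^ 2 * x.1 / (1 + c ^ 2)) ^ 3 := by gcongr
    _ = 2 * ((1 + c ^ 2) ^ 3 / s ^ 3) / (2 * x.1) := by field_simp
    _ ≤ _ := by gcongr

end Arc

/-- A linear functional on the plane with prescribed coefficients. -/
def planeFunctional (a b : ℝ) : ℝ × ℝ →L[ℝ] ℝ :=
  a • ContinuousLinearMap.fst ℝ ℝ ℝ + b • ContinuousLinearMap.snd ℝ ℝ ℝ

@[simp]
theorem planeFunctional_apply (a b : ℝ) (x : ℝ × ℝ) :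
    planeFunctional a b x = a * x.1 + b * x.2 := by
  simp [planeFunctional]

theorem fderiv_fderiv_apply_eq_zero_of_eqOn_linear {g : ℝ × ℝ → ℝ} {L₁ L₂ L : ℝ × ℝ →L[ℝ] ℝ}
    {p x : ℝ × ℝ} (hp : p ∈ openCone L₁ L₂) (h₁ : 0 ≤ L₁ x) (h₂ : 0 ≤ L₂ x)
    (heq : ∀ y, 0 ≤ L₁ y → 0 ≤ L₂ y → g y = L y) (hg : DifferentiableAt ℝ g x)
    (hg2 : DifferentiableAt ℝ (fderiv ℝ g) x) (v u : ℝ × ℝ) :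
    fderiv ℝ (fderiv ℝ g) x v u = 0 :=
  fderiv_fderiv_apply_eq_of_eqOn (G' := fun _ => L) (H := 0) (isOpen_openCone L₁ L₂)
    (uniqueDiffWithinAt_openCone hp h₁ h₂) (fun y hy => heq y hy.1.le hy.2.le) (heq x h₁ h₂) hg hg2
    (fun _ _ => L.hasFDerivAt) L.hasFDerivAt (hasFDerivAt_const _ _) v

/-- properties of the almost-linear Lyapunov function `g`:
for any function `g` with the defining properties (vanishing off `W(α)`, linear level
sides, circular-arc level tips), one has (i) `g(x) ≥ (s/2)‖x‖` on the arc region,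
(ii) a uniform positive lower bound on `∂₁ g` on `W(α)`, and (iii) second partial
derivatives bounded by `C‖x‖⁻¹`. -/
theorem lyapunov_g_properties
    (α : ℝ) (hα0 : 0 < α) (hα2 : α < Real.pi / 2)
    (g : ℝ × ℝ → ℝ)
    (hg_nonneg : ∀ x, 0 ≤ g x)
    (hg_zero : ∀ x : ℝ × ℝ, x ∉ WRc α → g x = 0)
    (hg_lin : ∀ x : ℝ × ℝ, x ∈ WRc α →
      Real.sin α * Real.cos α / (1 + Real.cos α ^ 2) * x.1 ≤ |x.2| →
      g x = Real.sin α * x.1 - Real.cos α * |x.2|)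
    (hg_arc : ∀ x : ℝ × ℝ, x ∈ WRc α →
      |x.2| ≤ Real.sin α * Real.cos α / (1 + Real.cos α ^ 2) * x.1 →
      (2 * g x / Real.sin α - x.1) ^ 2 + x.2 ^ 2 = g x ^ 2 ∧
        x.1 ≤ 2 * g x / Real.sin α) :
    (∀ x : ℝ × ℝ, x ∈ WRc α →
      |x.2| ≤ Real.sin α * Real.cos α / (1 + Real.cos α ^ 2) * x.1 →
      Real.sin α / 2 * rnorm x ≤ g x) ∧
    (∃ ε : ℝ, 0 < ε ∧ ∀ x ∈ WRc α, DifferentiableAt ℝ g x →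
      ε ≤ fderiv ℝ g x (1, 0)) ∧
    (∃ C : ℝ, 0 < C ∧ ∀ x : ℝ × ℝ, x ≠ 0 →
      DifferentiableAt ℝ g x → DifferentiableAt ℝ (fderiv ℝ g) x →
      ∀ v u : ℝ × ℝ, v ∈ ({(1, 0), (0, 1)} : Set (ℝ × ℝ)) →
        u ∈ ({(1, 0), (0, 1)} : Set (ℝ × ℝ)) →
        |fderiv ℝ (fderiv ℝ g) x v u| ≤ C / rnorm x) := by
  have hs : 0 < Real.sin α := Real.sin_pos_of_pos_of_lt_pi hα0 (by linarith [Real.pi_pos])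
  have hc : 0 < Real.cos α := Real.cos_pos_of_mem_Ioo ⟨by linarith, hα2⟩
  have hsc := Real.sin_sq_add_cos_sq α
  have hW := mem_WRc_iff hs hc
  generalize Real.sin α = s at *
  generalize Real.cos α = c at *
  set a := s * c / (1 + c ^ 2) with ha_def
  have ha : 0 < a := by positivity
  have hs1 : s < 1 := by nlinarith
  have hac : c * a < s := by
    rw [ha_def, mul_div_assoc', div_lt_iff₀ (by positivity)]
    nlinarith
  have ha_sc : a < s * c := div_lt_self (by positivity) (by nlinarith)
  have hm : 0 < 4 - s ^ 2 := by nlinarith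
  have arc_mem : ∀ {x : ℝ × ℝ}, 0 < x.1 → |x.2| ≤ a * x.1 → x ∈ WRc α := fun {x} h1 h2 => by
    rw [hW]; nlinarith
  have pos_of_mem : ∀ {x : ℝ × ℝ}, x ∈ WRc α → 0 < x.1 := fun {x} h => by
    rw [hW] at h
    exact pos_of_mul_pos_right (lt_of_le_of_lt (by positivity) h) hs.le
  -- On each of the two closed side cones, `g` is linear.
  have side_eq : ∀ σ : ℝ, |σ| = 1 → ∀ y : ℝ × ℝ, 0 ≤ planeFunctional (-a) σ y →
      0 ≤ planeFunctional s (-(c * σ)) y → g y = planeFunctional s (-(c * σ)) y := by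
    intro σ hσ y h1 h2
    rw [planeFunctional_apply] at *
    have hy1 : 0 ≤ y.1 := by
      have : 0 ≤ (s - c * a) * y.1 := by nlinarith
      exact nonneg_of_mul_nonneg_right this (by linarith)
    have habs : |y.2| = σ * y.2 := by
      rw [← one_mul |y.2|, ← hσ, ← abs_mul]
      exact abs_of_nonneg (by nlinarith)
    by_cases hy : y ∈ WRc α
    · rw [hg_lin y hy (by rw [habs]; linarith), habs]
      ring
    · rw [hg_zero y hy]
      rw [hW, habs] at hy
      linarith
  have side_mem : ∀ σ : ℝ, |σ| = 1 → ((1, σ * (s * c)) : ℝ × ℝ) ∈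
      openCone (planeFunctional (-a) σ) (planeFunctional s (-(c * σ))) := by
    intro σ hσ
    have hσ2 : σ ^ 2 = 1 := by rw [← sq_abs, hσ, one_pow]
    constructor <;> rw [planeFunctional_apply] <;> dsimp only
    · linear_combination ha_sc - s * c * hσ2
    · have : 0 < s ^ 3 := by positivity
      linear_combination this + s * c ^ 2 * hσ2 + s * hsc
  have exists_sign : ∀ t : ℝ, ∃ σ : ℝ, |σ| = 1 ∧ |t| = σ * t := fun t => by
    rcases abs_choice t with h | h
    · exact ⟨1, by simp, by simpa using h⟩
    · exact ⟨-1, by simp, by simpa using h⟩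
  -- On the central cone, `g` is the explicit root.
  have arc_eq : ∀ y : ℝ × ℝ, 0 < y.1 → |y.2| ≤ a * y.1 → g y = arcLevel s y := fun y h1 h2 =>
    eq_arcLevel hc hsc hs h1 h2 (hg_arc y (arc_mem h1 h2) h2).1 (hg_arc y (arc_mem h1 h2) h2).2
  have arc_cone : ∀ y ∈ openCone (planeFunctional a (-1)) (planeFunctional a 1),
      0 < y.1 ∧ |y.2| ≤ a * y.1 := by
    rintro y ⟨h1, h2⟩
    rw [planeFunctional_apply] at h1 h2
    exact ⟨pos_of_mul_pos_right (a := a) (by linarith) ha.le,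
      abs_le.mpr ⟨by linarith, by linarith⟩⟩
  have arc_unique : ∀ x : ℝ × ℝ, |x.2| ≤ a * x.1 →
      UniqueDiffWithinAt ℝ (openCone (planeFunctional a (-1)) (planeFunctional a 1)) x := by
    intro x hx
    have := abs_le.mp hx
    refine uniqueDiffWithinAt_openCone (p := (1, 0)) ⟨?_, ?_⟩ ?_ ?_
    · simpa using ha
    · simpa using ha
    · rw [planeFunctional_apply]
      linarith
    · rw [planeFunctional_apply]
      linarith
  have arc_deriv : ∀ y : ℝ × ℝ, 0 < y.1 → |y.2| ≤ a * y.1 →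
      HasFDerivAt (arcLevel s) (arcLevelDeriv s y) y := fun y h1 h2 =>
    hasFDerivAt_arcLevel hm.ne' (arcDisc_pos hsc hs h1 h2)
  refine ⟨fun x hx hxa => ?_, ⟨s / 2, by positivity, fun x hx hd => ?_⟩,
    ⟨2 * ((1 + c ^ 2) ^ 3 / s ^ 3), by positivity, fun x hx0 hd hd2 v u hv hu => ?_⟩⟩
  · obtain ⟨h1, h2⟩ := hg_arc x hx hxa
    exact half_mul_rnorm_le_of_arc hc hsc hs (pos_of_mem hx) hxa h1 h2
  · have hx1 := pos_of_mem hx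
    rcases le_total |x.2| (a * x.1) with h | h
    · rw [fderiv_eq_of_eqOn (arc_unique x h)
        (fun y hy => arc_eq y (arc_cone y hy).1 (arc_cone y hy).2) (arc_eq x hx1 h) hd
        (arc_deriv x hx1 h)]
      have : 0 ≤ s ^ 2 * x.1 / √(arcDisc s x) := by positivity
      have h4 : s / 4 ≤ s / (4 - s ^ 2) := by
        apply div_le_div_of_nonneg_left hs.le hm
        nlinarith
      simp only [arcLevelDeriv, sub_apply, smul_apply,
        ContinuousLinearMap.coe_fst', ContinuousLinearMap.coe_snd', smul_eq_mul]
      nlinarith [mul_nonneg (div_pos hs hm).le this]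
    · obtain ⟨σ, hσ, hσx⟩ := exists_sign x.2
      have h1 : 0 ≤ planeFunctional (-a) σ x := by rw [planeFunctional_apply]; linarith
      have h2 : 0 ≤ planeFunctional s (-(c * σ)) x := by
        rw [hW, hσx] at hx
        rw [planeFunctional_apply]
        linarith
      rw [fderiv_eq_of_eqOn (uniqueDiffWithinAt_openCone (side_mem σ hσ) h1 h2)
        (fun y hy => side_eq σ hσ y hy.1.le hy.2.le) (side_eq σ hσ x h1 h2) hd
        (ContinuousLinearMap.hasFDerivAt _), planeFunctional_apply]
      dsimp only
      linarith
  · have hr : 0 ≤ rnorm x := Real.sqrt_nonneg _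
    have of_zero : fderiv ℝ (fderiv ℝ g) x v u = 0 →
        |fderiv ℝ (fderiv ℝ g) x v u| ≤ 2 * ((1 + c ^ 2) ^ 3 / s ^ 3) / rnorm x := fun h => by
      rw [h, abs_zero]
      positivity
    obtain ⟨σ, hσ, hσx⟩ := exists_sign x.2
    by_cases hx : x ∈ WRc α
    swap
    · refine of_zero (fderiv_fderiv_apply_eq_zero_of_eqOn_linear
        (L₁ := planeFunctional (-s) (c * σ)) (L₂ := planeFunctional (-s) (c * σ)) (L := 0)
        (p := (-1, 0)) ⟨?_, ?_⟩ ?_ ?_ (fun y hy _ => hg_zero y ?_) hd hd2 v u)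
      · simpa using hs
      · simpa using hs
      · rw [hW, hσx] at hx
        rw [planeFunctional_apply]
        linarith
      · rw [hW, hσx] at hx
        rw [planeFunctional_apply]
        linarith
      · rw [planeFunctional_apply] at hy
        rw [hW, not_lt]
        have : σ * y.2 ≤ |y.2| := by
          rw [← one_mul |y.2|, ← hσ, ← abs_mul]
          exact le_abs_self _
        nlinarith
    have hx1 := pos_of_mem hx
    rcases le_total |x.2| (a * x.1) with h | h
    swap
    · refine of_zero (fderiv_fderiv_apply_eq_zero_of_eqOn_linear (side_mem σ hσ) ?_ ?_
        (side_eq σ hσ) hd hd2 v u)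
      · rw [planeFunctional_apply]
        linarith
      · rw [hW, hσx] at hx
        rw [planeFunctional_apply]
        linarith
    have hx2 : |x.2| ≤ x.1 := h.trans (mul_le_of_le_one_left hx1.le (by nlinarith))
    have hdisc := arcDisc_pos hsc hs hx1 h
    have second : ∀ {H : ℝ × ℝ →L[ℝ] ℝ}, HasFDerivAt (fun y => arcLevelDeriv s y u) H x →
        fderiv ℝ (fderiv ℝ g) x v u = H v := fun hH =>
      fderiv_fderiv_apply_eq_of_eqOn (isOpen_openCone _ _) (arc_unique x h)
        (fun y hy => arc_eq y (arc_cone y hy).1 (arc_cone y hy).2) (arc_eq x hx1 h) hd hd2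
        (fun y hy => arc_deriv y (arc_cone y hy).1 (arc_cone y hy).2) (arc_deriv x hx1 h) hH v
    have bound : ∀ {w : ℝ}, |w| ≤ x.1 ^ 2 →
        |s ^ 3 * w / √(arcDisc s x) ^ 3| ≤ 2 * ((1 + c ^ 2) ^ 3 / s ^ 3) / rnorm x :=
      fun hw => abs_div_sqrt_arcDisc_le hc hsc hs hx1 h hw
    have b22 : |x.2 ^ 2| ≤ x.1 ^ 2 := by
      rw [abs_pow]
      exact pow_le_pow_left₀ (abs_nonneg _) hx2 2
    have b12 : |x.1 * x.2| ≤ x.1 ^ 2 := by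
      rw [abs_mul, abs_of_pos hx1, sq]
      exact mul_le_mul_of_nonneg_left hx2 hx1.le
    have b11 : |x.1 ^ 2| ≤ x.1 ^ 2 := by rw [abs_of_nonneg (sq_nonneg _)]
    rcases hu with rfl | rfl
    · rw [second (hasFDerivAt_arcLevelDeriv_fst hm.ne' hdisc)]
      rcases hv with rfl | rfl
      · simpa [mul_assoc] using bound b22
      · simpa [mul_assoc] using bound b12
    · rw [second (hasFDerivAt_arcLevelDeriv_snd hdisc)]
      rcases hv with rfl | rfl
      · simpa [mul_assoc] using bound b12
      · simpa [mul_assoc] using bound b11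
end
end

section
/- Suppose (A1) and (A2) hold and that ‖μ(x)‖ → 0 as ‖x‖ → ∞. Let α ∈ (0,π]. Then there exist ε, A, C ∈ (0,∞) such that for every x ∈ W(α) with ‖x‖ ≥ A, P[Ξ hits the closed ball B_C((ε‖x‖, 0)) before hitting ℝ² ∖ W(α) | ξ₀ = x] > 0. -/
open MeasureTheory
open scoped ENNReal

noncomputable section

/-- Euclidean norm of a lattice point in `ℤ²`. -/
def znorm (x : ℤ × ℤ) : ℝ := Real.sqrt ((x.1 : ℝ) ^ 2 + (x.2 : ℝ) ^ 2)

/-- Polar angle in `(-π, π]` of a lattice point. -/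
def ang (x : ℤ × ℤ) : ℝ := Complex.arg ⟨(x.1 : ℝ), (x.2 : ℝ)⟩

/-- The harmonic function `f_w(x) = r^w cos(w φ)` in polar coordinates. -/
def fw (w : ℝ) (x : ℤ × ℤ) : ℝ := znorm x ^ w * Real.cos (w * ang x)

/-- First component of the mean drift at `x` given jump pmf `p`. -/
def mu1 (p : ℤ × ℤ → ℤ × ℤ → ℝ) (x : ℤ × ℤ) : ℝ := ∑' y : ℤ × ℤ, p x y * (y.1 : ℝ)

/-- Second component of the mean drift at `x`. -/
def mu2 (p : ℤ × ℤ → ℤ × ℤ → ℝ) (x : ℤ × ℤ) : ℝ := ∑' y : ℤ × ℤ, p x y * (y.2 : ℝ)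

/-- Euclidean norm of the mean drift at `x`. -/
def muNorm (p : ℤ × ℤ → ℤ × ℤ → ℝ) (x : ℤ × ℤ) : ℝ :=
  Real.sqrt (mu1 p x ^ 2 + mu2 p x ^ 2)

/-- Second moment `M₁₁(x)`. -/
def M11 (p : ℤ × ℤ → ℤ × ℤ → ℝ) (x : ℤ × ℤ) : ℝ := ∑' y : ℤ × ℤ, p x y * (y.1 : ℝ) ^ 2

/-- Second moment `M₂₂(x)`. -/
def M22 (p : ℤ × ℤ → ℤ × ℤ → ℝ) (x : ℤ × ℤ) : ℝ := ∑' y : ℤ × ℤ, p x y * (y.2 : ℝ) ^ 2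

/-- Mixed second moment `M₁₂(x)`. -/
def M12 (p : ℤ × ℤ → ℤ × ℤ → ℝ) (x : ℤ × ℤ) : ℝ :=
  ∑' y : ℤ × ℤ, p x y * ((y.1 : ℝ) * (y.2 : ℝ))

/-- `p` is a family of probability mass functions on `ℤ²` (the jump laws `θ(x)`). -/
def IsJumpPMF (p : ℤ × ℤ → ℤ × ℤ → ℝ) : Prop :=
  (∀ x y, 0 ≤ p x y) ∧ ∀ x, HasSum (p x) 1

/-- (A2): jumps are uniformly bounded by `b`: `P[‖θ(x)‖ > b] = 0` for all `x`. -/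
def A2 (p : ℤ × ℤ → ℤ × ℤ → ℝ) (b : ℝ) : Prop :=
  ∀ x y, b < znorm y → p x y = 0

section walk

variable {Ω : Type*} [MeasurableSpace Ω]

/-- `ξ` is a time-homogeneous Markov chain with one-step jump law `p`:
conditionally on the past and on `ξ_t = x`, the law of `ξ_{t+1} - ξ_t` is `p x`. -/
def IsMarkovWith (P : Measure Ω) (ξ : ℕ → Ω → ℤ × ℤ) (p : ℤ × ℤ → ℤ × ℤ → ℝ) : Prop :=
  ∀ (t : ℕ) (x y : ℤ × ℤ) (A : Set Ω),
    MeasurableSet[⨆ s ∈ Finset.range (t + 1), MeasurableSpace.comap (ξ s) ⊤] A →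
    P (A ∩ {ω | ξ t ω = x} ∩ {ω | ξ (t + 1) ω = x + y}) =
      ENNReal.ofReal (p x y) * P (A ∩ {ω | ξ t ω = x})

/-- (A1): uniform weak isotropy: from any `x ∈ S`, in `n₀` steps the walk moves by
each of `±k e₁, ±k e₂` with conditional probability at least `κ`. -/
def A1 (P : Measure Ω) (S : Set (ℤ × ℤ)) (ξ : ℕ → Ω → ℤ × ℤ)
    (κ : ℝ) (k n₀ : ℕ) : Prop :=
  ∀ (t : ℕ), ∀ x ∈ S,
    ∀ y ∈ ({((k : ℤ), (0 : ℤ)), (-(k : ℤ), 0), (0, (k : ℤ)), (0, -(k : ℤ))} : Set (ℤ × ℤ)),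
      ENNReal.ofReal κ * P {ω | ξ t ω = x} ≤
        P ({ω | ξ t ω = x} ∩ {ω | ξ (t + n₀) ω = x + y})

/-- First exit time from a region `Wm`, with value `∞` if the walk never leaves. -/
def exitTime (Wm : Set (ℤ × ℤ)) (ξ : ℕ → Ω → ℤ × ℤ) (ω : Ω) : ℝ≥0∞ :=
  ⨅ (t : ℕ) (_ : ξ t ω ∉ Wm), (t : ℝ≥0∞)

end walk

/-- The wedge `W(α)` for `α ∈ (0,π)`, together with the `α = π` case, where
`W(π) = ℝ² \ H_b` is the complement of the thickened half-line of half-width `b`. -/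
def Wset (b α : ℝ) : Set (ℤ × ℤ) :=
  {x | (α < Real.pi ∧ znorm x * Real.cos α < (x.1 : ℝ)) ∨
       (α = Real.pi ∧ ¬ ((x.1 : ℝ) ≤ 0 ∧ |(x.2 : ℝ)| ≤ b))}

/-- The wedge `W(α) = {x : r > 0, -α < φ < α}` in polar form, for `α ∈ (0,π]`. -/
def WsetArg (α : ℝ) : Set (ℤ × ℤ) :=
  {x | 0 < znorm x ∧ -α < ang x ∧ ang x < α}

end

open Relation

/-- A one-step transition of positive probability that lands in `W`. -/
def StepIn (p : ℤ × ℤ → ℤ × ℤ → ℝ) (W : Set (ℤ × ℤ)) (a c : ℤ × ℤ) : Prop :=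
  0 < p a (c - a) ∧ c ∈ W

/-- The four lattice displacements `±k e₁, ±k e₂`. -/
def axisMoves (k : ℕ) : Set (ℤ × ℤ) :=
  {((k : ℤ), (0 : ℤ)), (-(k : ℤ), 0), (0, (k : ℤ)), (0, -(k : ℤ))}

/-- The linear functional with coefficients `u`, `v` on lattice points. -/
def lin (u v : ℝ) (x : ℤ × ℤ) : ℝ := u * x.1 + v * x.2

lemma lin_add (u v : ℝ) (x y : ℤ × ℤ) : lin u v (x + y) = lin u v x + lin u v y := by
  simp only [lin, Prod.fst_add, Prod.snd_add]
  push_cast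
  ring

lemma znorm_eq_norm (x : ℤ × ℤ) : znorm x = ‖(⟨(x.1 : ℝ), (x.2 : ℝ)⟩ : ℂ)‖ := by
  rw [znorm, Complex.norm_def, Complex.normSq_mk]
  congr 1
  ring

lemma abs_fst_le_znorm (x : ℤ × ℤ) : |(x.1 : ℝ)| ≤ znorm x := by
  rw [znorm_eq_norm]
  exact Complex.abs_re_le_norm ⟨(x.1 : ℝ), (x.2 : ℝ)⟩

lemma abs_snd_le_znorm (x : ℤ × ℤ) : |(x.2 : ℝ)| ≤ znorm x := by
  rw [znorm_eq_norm]
  exact Complex.abs_im_le_norm ⟨(x.1 : ℝ), (x.2 : ℝ)⟩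

lemma znorm_le_abs_add_abs (x : ℤ × ℤ) : znorm x ≤ |(x.1 : ℝ)| + |(x.2 : ℝ)| := by
  rw [znorm_eq_norm]
  exact Complex.norm_le_abs_re_add_abs_im ⟨(x.1 : ℝ), (x.2 : ℝ)⟩

lemma abs_fst_sub_le_dist (x y : ℤ × ℤ) : |(x.1 : ℝ) - y.1| ≤ dist x y := by
  rw [Prod.dist_eq, Int.dist_eq]
  exact le_max_left _ _

lemma abs_snd_sub_le_dist (x y : ℤ × ℤ) : |(x.2 : ℝ) - y.2| ≤ dist x y := by
  rw [Prod.dist_eq, Int.dist_eq x.2]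
  exact le_max_right _ _

lemma znorm_le_znorm_add_dist (x y : ℤ × ℤ) : znorm x ≤ znorm y + 2 * dist x y := by
  have h : znorm x ≤ znorm y + znorm (x - y) := by
    simp only [znorm_eq_norm]
    refine le_trans (le_of_eq ?_) (norm_add_le _ _)
    congr 1
    apply Complex.ext <;> simp
  have h2 := znorm_le_abs_add_abs (x - y)
  have h3 := abs_fst_sub_le_dist x y
  have h4 := abs_snd_sub_le_dist x y
  simp only [Prod.fst_sub, Prod.snd_sub, Int.cast_sub] at h2
  linarith

lemma dist_le_znorm_sub (x y : ℤ × ℤ) : dist x y ≤ znorm (x - y) := by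
  rw [Prod.dist_eq, Int.dist_eq, Int.dist_eq]
  have h1 := abs_fst_le_znorm (x - y)
  have h2 := abs_snd_le_znorm (x - y)
  simp only [Prod.fst_sub, Prod.snd_sub, Int.cast_sub] at h1 h2
  exact max_le h1 h2

lemma exists_finset_znorm_le (b : ℝ) : ∃ B : Finset (ℤ × ℤ), ∀ y, znorm y ≤ b → y ∈ B := by
  have hf : (Metric.closedBall (0 : ℤ × ℤ) b).Finite :=
    (isCompact_closedBall _ _).finite_of_discrete
  refine ⟨hf.toFinset, fun y hy => ?_⟩
  rw [Set.Finite.mem_toFinset, Metric.mem_closedBall]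
  exact (dist_le_znorm_sub y 0).trans (by simpa using hy)

lemma exists_pos_le_abs_lin (B : Finset (ℤ × ℤ)) (u v : ℝ) :
    ∃ c : ℝ, 0 < c ∧ ∀ y ∈ B, lin u v y ≠ 0 → c ≤ |lin u v y| := by
  induction B using Finset.induction_on with
  | empty => exact ⟨1, one_pos, by simp⟩
  | insert a B _ ih =>
    obtain ⟨c, hc, h⟩ := ih
    by_cases ha : lin u v a = 0
    · refine ⟨c, hc, fun y hy hne => ?_⟩
      rcases Finset.mem_insert.1 hy with rfl | hy
      · exact absurd ha hne
      · exact h y hy hne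
    · refine ⟨min c |lin u v a|, lt_min hc (abs_pos.2 ha), fun y hy hne => ?_⟩
      rcases Finset.mem_insert.1 hy with rfl | hy
      · exact min_le_right _ _
      · exact (min_le_left _ _).trans (h y hy hne)

lemma measurableSet_past {Ω : Type*} {ξ : ℕ → Ω → ℤ × ℤ} {s t : ℕ} (h : s ≤ t) (U : Set (ℤ × ℤ)) :
    MeasurableSet[⨆ r ∈ Finset.range (t + 1), MeasurableSpace.comap (ξ r) ⊤]
      {ω | ξ s ω ∈ U} := by
  have hle : MeasurableSpace.comap (ξ s) ⊤ ≤
      ⨆ r ∈ Finset.range (t + 1), MeasurableSpace.comap (ξ r) ⊤ :=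
    le_iSup₂_of_le s (Finset.mem_range.2 (by omega)) le_rfl
  exact hle _ ⟨U, trivial, rfl⟩

section probability

variable {Ω : Type*} [MeasurableSpace Ω] {P : Measure Ω} {ξ : ℕ → Ω → ℤ × ℤ}
  {p : ℤ × ℤ → ℤ × ℤ → ℝ}

lemma exists_time_measure_ne_zero (hM : IsMarkovWith P ξ p) {W : Set (ℤ × ℤ)} {x z : ℤ × ℤ}
    (hx : P {ω | ξ 0 ω = x} ≠ 0) (hxW : x ∈ W) (h : ReflTransGen (StepIn p W) x z) :
    ∃ t, P (({ω | ∀ s ≤ t, ξ s ω ∈ W} ∩ {ω | ξ 0 ω = x}) ∩ {ω | ξ t ω = z}) ≠ 0 := by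
  induction h with
  | refl =>
    refine ⟨0, ?_⟩
    convert hx using 2
    ext ω
    simp only [Set.mem_inter_iff, Set.mem_ofPred_eq, Nat.le_zero, forall_eq]
    constructor
    · exact fun h => h.2
    · exact fun h => ⟨⟨h ▸ hxW, h⟩, h⟩
  | @tail a c _ hac ih =>
    obtain ⟨t, ht⟩ := ih
    refine ⟨t + 1, ?_⟩
    have hA : MeasurableSet[⨆ r ∈ Finset.range (t + 1), MeasurableSpace.comap (ξ r) ⊤]
        ({ω | ∀ s ≤ t, ξ s ω ∈ W} ∩ {ω | ξ 0 ω = x}) := by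
      refine MeasurableSet.inter ?_ (measurableSet_past (Nat.zero_le t) {x})
      have : {ω | ∀ s ≤ t, ξ s ω ∈ W} = ⋂ s, ⋂ _ : s ≤ t, {ω | ξ s ω ∈ W} := by
        ext ω
        simp
      rw [this]
      exact MeasurableSet.iInter fun s => MeasurableSet.iInter fun hs => measurableSet_past hs W
    have key := hM t a (c - a) _ hA
    have hne : ENNReal.ofReal (p a (c - a)) *
        P (({ω | ∀ s ≤ t, ξ s ω ∈ W} ∩ {ω | ξ 0 ω = x}) ∩ {ω | ξ t ω = a}) ≠ 0 :=
      mul_ne_zero (by simpa using hac.1) ht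
    rw [← key] at hne
    refine fun h0 => hne (measure_mono_null ?_ h0)
    rintro ω ⟨⟨⟨h1, h2⟩, _⟩, h4⟩
    have h5 : ξ (t + 1) ω = c := by
      have : ξ (t + 1) ω = a + (c - a) := h4
      simpa using this
    refine ⟨⟨fun s hs => ?_, h2⟩, h5⟩
    rcases Nat.le_succ_iff.1 hs with hs | rfl
    · exact h1 s hs
    · rw [h5]
      exact hac.2

lemma measure_step_le (hM : IsMarkovWith P ξ p) (hmeas : ∀ t, Measurable (ξ t)) {t s : ℕ}
    (hts : t ≤ s) (x d : ℤ × ℤ) (U : Set (ℤ × ℤ)) {η : ℝ} (hU : ∀ z ∈ U, p z d ≤ η) :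
    P ({ω | ξ t ω = x} ∩ {ω | ξ s ω ∈ U ∧ ξ (s + 1) ω = ξ s ω + d}) ≤
      ENNReal.ofReal η * P {ω | ξ t ω = x} := by
  have hsub : {ω | ξ t ω = x} ∩ {ω | ξ s ω ∈ U ∧ ξ (s + 1) ω = ξ s ω + d} ⊆
      ⋃ z : ℤ × ℤ, {ω | ξ t ω = x} ∩ {ω | ξ s ω = z ∧ z ∈ U} ∩ {ω | ξ (s + 1) ω = z + d} := by
    rintro ω ⟨h1, h2, h3⟩
    exact Set.mem_iUnion.2 ⟨ξ s ω, ⟨h1, rfl, h2⟩, h3⟩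
  have hsing : ∀ r (z : ℤ × ℤ), MeasurableSet {ω | ξ r ω = z} := fun r z =>
    hmeas r (measurableSet_singleton z)
  calc _ ≤ ∑' z : ℤ × ℤ,
        P ({ω | ξ t ω = x} ∩ {ω | ξ s ω = z ∧ z ∈ U} ∩ {ω | ξ (s + 1) ω = z + d}) :=
        (measure_mono hsub).trans (measure_iUnion_le _)
    _ ≤ ∑' z : ℤ × ℤ, ENNReal.ofReal η * P ({ω | ξ t ω = x} ∩ {ω | ξ s ω = z}) := by
        refine ENNReal.tsum_le_tsum fun z => ?_
        by_cases hz : z ∈ U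
        · simp only [hz, and_true]
          rw [hM s z d {ω | ξ t ω = x} (measurableSet_past hts {x})]
          gcongr
          exact hU z hz
        · simp [hz]
    _ = ENNReal.ofReal η * P {ω | ξ t ω = x} := by
        rw [ENNReal.tsum_mul_left, ← measure_iUnion]
        · congr 2
          ext ω
          simp
        · intro z w hzw
          refine Set.disjoint_left.2 fun ω h1 h2 => hzw ?_
          exact h1.2.symm.trans h2.2
        · exact fun z => (hsing t x).inter (hsing s z)

lemma exists_likely_path [IsProbabilityMeasure P] (hM : IsMarkovWith P ξ p)
    (hmeas : ∀ t, Measurable (ξ t)) {S : Set (ℤ × ℤ)} {κ : ℝ} {k n₀ : ℕ}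
    (hA1 : A1 P S ξ κ k n₀) {B : Finset (ℤ × ℤ)} (hB : ∀ z, ∀ d ∉ B, p z d = 0) {η : ℝ}
    (hη : 0 ≤ η) (hηκ : n₀ * (B.card * η) < κ) {t : ℕ} {x y : ℤ × ℤ} (hxS : x ∈ S)
    (hx : P {ω | ξ t ω = x} ≠ 0) (hy : y ∈ axisMoves k) :
    ∃ f : ℕ → ℤ × ℤ, f 0 = x ∧ f n₀ = x + y ∧ ∀ i < n₀, η < p (f i) (f (i + 1) - f i) := by
  by_contra! hno
  have hsub : {ω | ξ t ω = x} ∩ {ω | ξ (t + n₀) ω = x + y} ⊆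
      ⋃ i ∈ Finset.range n₀, ⋃ d : ℤ × ℤ, {ω | ξ t ω = x} ∩
        {ω | ξ (t + i) ω ∈ {z | p z d ≤ η} ∧ ξ (t + i + 1) ω = ξ (t + i) ω + d} := by
    rintro ω ⟨h1, h2⟩
    obtain ⟨i, hi, hp⟩ := hno (fun i => ξ (t + i) ω) h1 h2
    simp only [Set.mem_iUnion]
    refine ⟨i, Finset.mem_range.2 hi, ξ (t + (i + 1)) ω - ξ (t + i) ω, h1, hp, ?_⟩
    rw [add_sub_cancel]
    rfl
  have hone : ∀ i, P (⋃ d : ℤ × ℤ, {ω | ξ t ω = x} ∩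
      {ω | ξ (t + i) ω ∈ {z | p z d ≤ η} ∧ ξ (t + i + 1) ω = ξ (t + i) ω + d}) ≤
      B.card * ENNReal.ofReal η * P {ω | ξ t ω = x} := by
    intro i
    refine (measure_iUnion_le _).trans ?_
    rw [tsum_eq_sum (s := B)]
    · refine (Finset.sum_le_card_nsmul B _ _ fun d _ => measure_step_le hM hmeas
        (Nat.le_add_right t i) x d _ fun z hz => hz).trans ?_
      rw [nsmul_eq_mul, mul_assoc]
    · intro d hd
      have := measure_step_le hM hmeas (Nat.le_add_right t i) x d {z | p z d ≤ η} (η := 0)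
        fun z _ => (hB z d hd).le
      simpa using this
  have hle : ENNReal.ofReal κ * P {ω | ξ t ω = x} ≤
      ENNReal.ofReal (n₀ * (B.card * η)) * P {ω | ξ t ω = x} := by
    refine (hA1 t x hxS y hy).trans ((measure_mono hsub).trans
      ((measure_biUnion_finset_le _ _).trans ?_))
    refine (Finset.sum_le_card_nsmul _ _ _ fun i _ => hone i).trans ?_
    rw [nsmul_eq_mul, Finset.card_range, ENNReal.ofReal_mul (by positivity),
      ENNReal.ofReal_mul (by positivity), ENNReal.ofReal_natCast, ENNReal.ofReal_natCast]
    simp only [mul_assoc, le_refl]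
  rw [ENNReal.mul_le_mul_iff_left hx (measure_ne_top P _),
    ENNReal.ofReal_le_ofReal_iff (by positivity)] at hle
  linarith

end probability

lemma exists_jump_lin_pos {p : ℤ × ℤ → ℤ × ℤ → ℝ} (hp : IsJumpPMF p) {B : Finset (ℤ × ℤ)}
    (hB : ∀ z, ∀ d ∉ B, p z d = 0) {u v η δ c : ℝ} (hu : |u| ≤ 1) (hv : |v| ≤ 1)
    (hη : 0 ≤ η) (hc : 0 ≤ c) (hδ : 2 * δ < η * c)
    {z y : ℤ × ℤ} (hmu : muNorm p z ≤ δ) (hy : η < p z y) (hyc : lin u v y ≤ -c) :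
    ∃ d, 0 < p z d ∧ 0 < lin u v d := by
  by_contra! hno
  have h1 : mu1 p z = ∑ d ∈ B, p z d * (d.1 : ℝ) :=
    tsum_eq_sum fun d hd => by simp [hB z d hd]
  have h2 : mu2 p z = ∑ d ∈ B, p z d * (d.2 : ℝ) :=
    tsum_eq_sum fun d hd => by simp [hB z d hd]
  have hsum : u * mu1 p z + v * mu2 p z = ∑ d ∈ B, p z d * lin u v d := by
    rw [h1, h2, Finset.mul_sum, Finset.mul_sum, ← Finset.sum_add_distrib]
    refine Finset.sum_congr rfl fun d _ => ?_
    simp only [lin]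
    ring
  have hyB : y ∈ B := by
    by_contra h
    rw [hB z y h] at hy
    linarith
  have hle : ∑ d ∈ B, p z d * lin u v d ≤ p z y * lin u v y := by
    have := Finset.single_le_sum (s := B) (f := fun d => -(p z d * lin u v d))
      (fun d _ => by
        rcases (hp.1 z d).eq_or_lt with h | h
        · simp [← h]
        · have := mul_nonpos_of_nonneg_of_nonpos h.le (hno d h)
          linarith) hyB
    rw [Finset.sum_neg_distrib] at this
    linarith
  have hm1 : |mu1 p z| ≤ muNorm p z := Real.abs_le_sqrt (by nlinarith [sq_nonneg (mu2 p z)])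
  have hm2 : |mu2 p z| ≤ muNorm p z := Real.abs_le_sqrt (by nlinarith [sq_nonneg (mu1 p z)])
  have e1 : |u * mu1 p z| ≤ δ := by
    rw [abs_mul]
    nlinarith [abs_nonneg (mu1 p z), abs_nonneg u]
  have e2 : |v * mu2 p z| ≤ δ := by
    rw [abs_mul]
    nlinarith [abs_nonneg (mu2 p z), abs_nonneg v]
  have e3 := (abs_le.1 e1).1
  have e4 := (abs_le.1 e2).1
  have e5 : p z y * lin u v y ≤ -(η * c) := by nlinarith [hp.1 z y]
  linarith

section reachability

variable {p : ℤ × ℤ → ℤ × ℤ → ℝ} {W : Set (ℤ × ℤ)} {x : ℤ × ℤ} {k n₀ : ℕ} {b η : ℝ}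

lemma dist_add_le_of_pos (hA2 : A2 p b) {z d : ℤ × ℤ} (h : 0 < p z d) :
    dist (z + d) z ≤ b := by
  refine (dist_le_znorm_sub _ _).trans ?_
  rw [add_sub_cancel_left]
  by_contra! hlt
  exact h.ne' (hA2 z d hlt)

lemma reach_add_of_closedBall_subset (hb : 0 ≤ b) (hA2 : A2 p b) (hη : 0 ≤ η)
    (hpath : ∀ z, ReflTransGen (StepIn p W) x z → ∀ y ∈ axisMoves k,
      ∃ f : ℕ → ℤ × ℤ, f 0 = z ∧ f n₀ = z + y ∧ ∀ i < n₀, η < p (f i) (f (i + 1) - f i))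
    {z y : ℤ × ℤ} (hz : ReflTransGen (StepIn p W) x z) (hy : y ∈ axisMoves k)
    (hW : ∀ w, dist w z ≤ n₀ * b → w ∈ W) :
    ReflTransGen (StepIn p W) x (z + y) := by
  obtain ⟨f, hf0, hfn, hf⟩ := hpath z hz y hy
  have key : ∀ i ≤ n₀, ReflTransGen (StepIn p W) x (f i) ∧ dist (f i) z ≤ i * b := by
    intro i
    induction i with
    | zero => exact fun _ => ⟨hf0 ▸ hz, by simp [hf0]⟩
    | succ i ih =>
      intro hi
      obtain ⟨h1, h2⟩ := ih (by omega)
      have hp := hη.trans_lt (hf i (by omega))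
      have hd := dist_add_le_of_pos hA2 hp
      rw [add_sub_cancel] at hd
      have hd2 : dist (f (i + 1)) z ≤ (i + 1 : ℕ) * b := by
        push_cast
        linarith [dist_triangle (f (i + 1)) (f i) z]
      refine ⟨h1.tail ⟨hp, hW _ (hd2.trans ?_)⟩, hd2⟩
      gcongr
  exact hfn ▸ (key n₀ le_rfl).1

lemma exists_reach_lin_add_le (hp : IsJumpPMF p) {B : Finset (ℤ × ℤ)}
    (hB : ∀ z, ∀ d ∉ B, p z d = 0) (hb : 0 ≤ b) (hA2 : A2 p b) (hη : 0 ≤ η)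
    (hpath : ∀ z, ReflTransGen (StepIn p W) x z → ∀ y ∈ axisMoves k,
      ∃ f : ℕ → ℤ × ℤ, f 0 = z ∧ f n₀ = z + y ∧ ∀ i < n₀, η < p (f i) (f (i + 1) - f i))
    {r δ : ℝ} (hdr : ∀ z, ReflTransGen (StepIn p W) x z → r ≤ znorm z → muNorm p z ≤ δ)
    {u v c : ℝ} (hu : |u| ≤ 1) (hv : |v| ≤ 1) (hc : 0 ≤ c) (hδ : 2 * δ < η * c)
    (hBc : ∀ y ∈ B, lin u v y ≠ 0 → c ≤ |lin u v y|)
    (hne : ∃ y ∈ axisMoves k, lin u v y ≠ 0)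
    {z : ℤ × ℤ} (hz : ReflTransGen (StepIn p W) x z)
    (hW : ∀ w, dist w z ≤ n₀ * b → lin u v z ≤ lin u v w → w ∈ W)
    (hr : ∀ w, dist w z ≤ n₀ * b → r ≤ znorm w) :
    ∃ w, ReflTransGen (StepIn p W) x w ∧ lin u v z + c ≤ lin u v w ∧ dist w z ≤ n₀ * b := by
  obtain ⟨y, hy, hy0⟩ := hne
  obtain ⟨f, hf0, hfn, hf⟩ := hpath z hz y hy
  by_contra! hno
  have key : ∀ i ≤ n₀, ReflTransGen (StepIn p W) x (f i) ∧ dist (f i) z ≤ i * b ∧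
      lin u v (f i) = lin u v z := by
    intro i
    induction i with
    | zero => exact fun _ => ⟨hf0 ▸ hz, by simp [hf0], by rw [hf0]⟩
    | succ i ih =>
      intro hi
      obtain ⟨h1, h2, h3⟩ := ih (by omega)
      have hin : ((i + 1 : ℕ) : ℝ) * b ≤ n₀ * b := by gcongr
      have hstep : ∀ d, 0 < p (f i) d → dist (f i + d) z ≤ (i + 1 : ℕ) * b := by
        intro d hd
        push_cast
        linarith [dist_triangle (f i + d) (f i) z, dist_add_le_of_pos hA2 hd]
      have hmemB : ∀ d, 0 < p (f i) d → d ∈ B := by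
        intro d hd
        by_contra h
        exact hd.ne' (hB _ d h)
      have hnonneg : ∀ d, 0 < p (f i) d → 0 ≤ lin u v d →
          ReflTransGen (StepIn p W) x (f i + d) := by
        intro d hd hl
        refine h1.tail ⟨by simpa using hd, hW _ ((hstep d hd).trans hin) ?_⟩
        rw [lin_add]
        linarith
      have hup : ∀ d, 0 < p (f i) d → ¬ 0 < lin u v d := by
        intro d hd hl
        have h4 := hBc d (hmemB d hd) hl.ne'
        rw [abs_of_pos hl] at h4
        have h5 := hno _ (hnonneg d hd hl.le) (by rw [lin_add]; linarith)
        linarith [hstep d hd]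
      have hp1 := hf i (by omega)
      have hp0 := hη.trans_lt hp1
      have hz0 : lin u v (f (i + 1) - f i) = 0 := by
        by_contra hl
        have hneg := lt_of_le_of_ne (not_lt.1 (hup _ hp0)) hl
        have h4 := hBc _ (hmemB _ hp0) hl
        rw [abs_of_neg hneg] at h4
        have hi0 : (i : ℝ) * b ≤ n₀ * b := by
          gcongr
          omega
        obtain ⟨d, hd, hdl⟩ := exists_jump_lin_pos hp hB hu hv hη hc hδ
          (hdr _ h1 (hr _ (h2.trans hi0))) hp1 (by linarith)
        exact hup d hd hdl
      have hreach := hnonneg _ hp0 hz0.ge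
      have hdist := hstep _ hp0
      have hlin := lin_add u v (f i) (f (i + 1) - f i)
      rw [add_sub_cancel] at hreach hdist hlin
      exact ⟨hreach, hdist, by linarith⟩
  have := (key n₀ le_rfl).2.2
  rw [hfn, lin_add] at this
  exact hy0 (by linarith)

lemma exists_reach_lin_add_mul_le (hp : IsJumpPMF p) {B : Finset (ℤ × ℤ)}
    (hB : ∀ z, ∀ d ∉ B, p z d = 0) (hb : 0 ≤ b) (hA2 : A2 p b) (hη : 0 ≤ η)
    (hpath : ∀ z, ReflTransGen (StepIn p W) x z → ∀ y ∈ axisMoves k,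
      ∃ f : ℕ → ℤ × ℤ, f 0 = z ∧ f n₀ = z + y ∧ ∀ i < n₀, η < p (f i) (f (i + 1) - f i))
    {r δ : ℝ} (hdr : ∀ z, ReflTransGen (StepIn p W) x z → r ≤ znorm z → muNorm p z ≤ δ)
    {u v c : ℝ} (hu : |u| ≤ 1) (hv : |v| ≤ 1) (hc : 0 ≤ c) (hδ : 2 * δ < η * c)
    (hBc : ∀ y ∈ B, lin u v y ≠ 0 → c ≤ |lin u v y|)
    (hne : ∃ y ∈ axisMoves k, lin u v y ≠ 0) (N : ℕ)
    (hW : ∀ w, dist w x ≤ N * (n₀ * b) → lin u v x ≤ lin u v w → w ∈ W)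
    (hr : ∀ w, dist w x ≤ N * (n₀ * b) → r ≤ znorm w) :
    ∃ w, ReflTransGen (StepIn p W) x w ∧ lin u v x + N * c ≤ lin u v w ∧
      dist w x ≤ N * (n₀ * b) := by
  induction N with
  | zero => exact ⟨x, .refl, by simp, by simp⟩
  | succ N ih =>
    have hL : 0 ≤ (n₀ : ℝ) * b := by positivity
    push_cast at hW hr ⊢
    obtain ⟨z, hz, hzl, hzd⟩ := ih (fun w hw => hW w (by linarith)) fun w hw => hr w (by linarith)
    have hNc : 0 ≤ N * c := by positivity
    have htri : ∀ w, dist w z ≤ n₀ * b → dist w x ≤ (N + 1) * (n₀ * b) := fun w hw => by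
      linarith [dist_triangle w z x]
    obtain ⟨w, hw, hwl, hwd⟩ := exists_reach_lin_add_le hp hB hb hA2 hη hpath hdr hu hv hc hδ hBc
      hne hz (fun w hw hl => hW w (htri w hw) (by linarith)) fun w hw => hr w (htri w hw)
    exact ⟨w, hw, by linarith, htri w hwd⟩

lemma exists_reach_right (hk : 0 < k)
    (hmove : ∀ z, ReflTransGen (StepIn p W) x z → ∀ y ∈ axisMoves k,
      (∀ w, dist w z ≤ n₀ * b → w ∈ W) → ReflTransGen (StepIn p W) x (z + y))
    {z : ℤ × ℤ} (hz : ReflTransGen (StepIn p W) x z)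
    (hW : ∀ w : ℤ × ℤ, w.2 = z.2 → z.1 ≤ w.1 → ∀ v, dist v w ≤ n₀ * b → v ∈ W) (T : ℝ) :
    ∃ w, ReflTransGen (StepIn p W) x w ∧ w.2 = z.2 ∧ T ≤ w.1 ∧
      (w.1 : ℝ) ≤ max (z.1 : ℝ) (T + k) := by
  have hm : ∀ m : ℕ, ReflTransGen (StepIn p W) x (z.1 + m * k, z.2) := by
    intro m
    induction m with
    | zero => simpa using hz
    | succ m ih =>
      have := hmove _ ih ((k : ℤ), 0) (by simp [axisMoves]) (hW _ rfl (by
        simp only [le_add_iff_nonneg_right]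
        positivity))
      convert this using 1
      ext
      · simp
        ring
      · simp
  by_cases hT : T ≤ z.1
  · exact ⟨z, hz, rfl, hT, le_max_left _ _⟩
  · push Not at hT
    have hk' : (0 : ℝ) < k := by exact_mod_cast hk
    refine ⟨_, hm ⌈(T - z.1) / k⌉₊, rfl, ?_, le_max_of_le_right ?_⟩
    · have := Nat.le_ceil ((T - z.1) / k)
      rw [div_le_iff₀ hk'] at this
      push_cast
      linarith
    · have := Nat.ceil_lt_add_one (a := (T - z.1) / k) (div_nonneg (by linarith) hk'.le)
      have h2 : (⌈(T - z.1) / k⌉₊ : ℝ) * k ≤ ((T - z.1) / k + 1) * k := by gcongr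
      rw [add_mul, div_mul_cancel₀ _ hk'.ne'] at h2
      push_cast
      linarith

lemma exists_reach_vertical (hk : 0 < k)
    (hmove : ∀ z, ReflTransGen (StepIn p W) x z → ∀ y ∈ axisMoves k,
      (∀ w, dist w z ≤ n₀ * b → w ∈ W) → ReflTransGen (StepIn p W) x (z + y))
    {z : ℤ × ℤ} (hz : ReflTransGen (StepIn p W) x z)
    (hW : ∀ w : ℤ × ℤ, w.1 = z.1 → |w.2| ≤ |z.2| → ∀ v, dist v w ≤ n₀ * b → v ∈ W) :
    ∃ w, ReflTransGen (StepIn p W) x w ∧ w.1 = z.1 ∧ |w.2| ≤ k ∧ |w.2| ≤ |z.2| := by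
  induction hn : z.2.natAbs using Nat.strong_induction_on generalizing z with
  | _ n ih =>
    by_cases hzk : |z.2| ≤ k
    · exact ⟨z, hz, rfl, hzk, le_rfl⟩
    have hstep : ∃ y ∈ axisMoves k, (z + y).1 = z.1 ∧ (z + y).2.natAbs < n := by
      rcases le_total 0 z.2 with h | h
      · refine ⟨(0, -(k : ℤ)), by simp [axisMoves], by simp, ?_⟩
        rw [abs_of_nonneg h] at hzk
        simp only [Prod.snd_add]
        omega
      · refine ⟨(0, (k : ℤ)), by simp [axisMoves], by simp, ?_⟩
        rw [abs_of_nonpos h] at hzk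
        simp only [Prod.snd_add]
        omega
    obtain ⟨y, hy, hy1, hy2⟩ := hstep
    have hle : |(z + y).2| ≤ |z.2| := by
      rw [Int.abs_eq_natAbs, Int.abs_eq_natAbs]
      omega
    obtain ⟨w, hw, hw1, hw2, hw3⟩ := ih _ hy2 (hmove z hz y hy (hW z rfl le_rfl))
      (fun w h1 h2 => hW w (h1.trans hy1) (h2.trans hle)) rfl
    exact ⟨w, hw, hw1.trans hy1, hw2, hw3.trans hle⟩

lemma exists_reach_axis_right_first (hk : 0 < k)
    (hmove : ∀ z, ReflTransGen (StepIn p W) x z → ∀ y ∈ axisMoves k,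
      (∀ w, dist w z ≤ n₀ * b → w ∈ W) → ReflTransGen (StepIn p W) x (z + y))
    {z : ℤ × ℤ} (hz : ReflTransGen (StepIn p W) x z) {R T : ℝ} (hR : 0 ≤ R) (hzT : z.1 ≤ T + R)
    (hW : ∀ w : ℤ × ℤ, w.2 = z.2 → z.1 ≤ w.1 → ∀ v, dist v w ≤ n₀ * b → v ∈ W)
    (hW' : ∀ w : ℤ × ℤ, T ≤ w.1 → ∀ v, dist v w ≤ n₀ * b → v ∈ W) :
    ∃ w, ReflTransGen (StepIn p W) x w ∧ |(w.1 : ℝ) - T| ≤ R + k ∧ |(w.2 : ℝ)| ≤ k := by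
  obtain ⟨w, hw, -, hwT, hwm⟩ := exists_reach_right hk hmove hz hW T
  obtain ⟨q, hq, hq1, hq2, -⟩ := exists_reach_vertical hk hmove hw
    fun v hv _ => hW' v (by rw [hv]; exact hwT)
  refine ⟨q, hq, ?_, by exact_mod_cast hq2⟩
  have hk0 : (0 : ℝ) ≤ k := by positivity
  have := hwm.trans (max_le (c := T + R + k) (by linarith) (by linarith))
  rw [hq1, abs_le]
  constructor <;> linarith

lemma exists_reach_axis_vertical_first (hk : 0 < k)
    (hmove : ∀ z, ReflTransGen (StepIn p W) x z → ∀ y ∈ axisMoves k,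
      (∀ w, dist w z ≤ n₀ * b → w ∈ W) → ReflTransGen (StepIn p W) x (z + y))
    {z : ℤ × ℤ} (hz : ReflTransGen (StepIn p W) x z) {R T : ℝ} (hR : 0 ≤ R) (hzT : z.1 ≤ T + R)
    (hW : ∀ w : ℤ × ℤ, z.1 ≤ w.1 → |w.2| ≤ |z.2| → ∀ v, dist v w ≤ n₀ * b → v ∈ W) :
    ∃ w, ReflTransGen (StepIn p W) x w ∧ |(w.1 : ℝ) - T| ≤ R + k ∧ |(w.2 : ℝ)| ≤ k := by
  obtain ⟨q, hq, hq1, hq2, hq3⟩ := exists_reach_vertical hk hmove hz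
    fun v hv => hW v hv.ge
  obtain ⟨w, hw, hw2, hwT, hwm⟩ := exists_reach_right hk hmove hq
    (fun v hv hv1 => hW v (hq1 ▸ hv1) (hv ▸ hq3)) T
  refine ⟨w, hw, ?_, by rw [hw2]; exact_mod_cast hq2⟩
  have hk0 : (0 : ℝ) ≤ k := by positivity
  rw [hq1] at hwm
  have := hwm.trans (max_le (c := T + R + k) (by linarith) (by linarith))
  rw [abs_le]
  constructor <;> linarith

end reachability

lemma mem_Wset_iff_of_lt_pi {b α : ℝ} (hα0 : 0 < α) (hα : α < Real.pi) (x : ℤ × ℤ) :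
    x ∈ Wset b α ↔ 0 < Real.sin α * x.1 - Real.cos α * |(x.2 : ℝ)| := by
  have hs := Real.sin_pos_of_pos_of_lt_pi hα0 hα
  have hsc := Real.sin_sq_add_cos_sq α
  have hr : znorm x ^ 2 = (x.1 : ℝ) ^ 2 + (x.2 : ℝ) ^ 2 := Real.sq_sqrt (by positivity)
  have hr0 : 0 ≤ znorm x := Real.sqrt_nonneg _
  have hx2 := sq_abs (x.2 : ℝ)
  have ha := abs_nonneg (x.2 : ℝ)
  simp only [Wset, Set.mem_ofPred_eq, hα, true_and, hα.ne, false_and, or_false]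
  generalize Real.sin α = s at *
  generalize Real.cos α = c at *
  generalize znorm x = r at *
  generalize |(x.2 : ℝ)| = a at *
  generalize (x.1 : ℝ) = y at *
  rw [← hx2] at hr
  have hid : (s * y) ^ 2 - (c * a) ^ 2 = y ^ 2 - (r * c) ^ 2 := by
    have : s ^ 2 = 1 - c ^ 2 := by linarith
    rw [mul_pow, mul_pow, mul_pow, hr, this]
    ring
  rcases le_total 0 c with hc | hc
  · have h1 : 0 ≤ r * c := by positivity
    have h2 : 0 ≤ c * a := by positivity
    rw [sub_pos]
    constructor
    · intro h
      exact lt_of_pow_lt_pow_left₀ 2 (by nlinarith) (by nlinarith)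
    · intro h
      have : 0 < y := pos_of_mul_pos_right (h2.trans_lt h) hs.le
      exact lt_of_pow_lt_pow_left₀ 2 this.le (by nlinarith)
  · have h1 : r * c ≤ 0 := mul_nonpos_of_nonneg_of_nonpos hr0 hc
    have h2 : c * a ≤ 0 := mul_nonpos_of_nonpos_of_nonneg hc ha
    rw [← not_iff_not, not_lt, not_lt]
    constructor
    · intro h
      have h3 : -(r * c) ≤ -y := by linarith
      have h4 : (r * c) ^ 2 ≤ y ^ 2 := by nlinarith
      have h5 : -(c * a) ≤ -(s * y) := le_of_sq_le_sq (by nlinarith) (by nlinarith)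
      linarith
    · intro h
      have h3 : -(c * a) ≤ -(s * y) := by linarith
      have hy : y ≤ 0 := by
        by_contra! hy
        nlinarith [mul_pos hs hy]
      have h4 : (c * a) ^ 2 ≤ (s * y) ^ 2 := by nlinarith
      have h5 : -(r * c) ≤ -y := le_of_sq_le_sq (by nlinarith) (by linarith)
      linarith

lemma mem_Wset_pi_iff {b : ℝ} (x : ℤ × ℤ) :
    x ∈ Wset b Real.pi ↔ 0 < (x.1 : ℝ) ∨ b < |(x.2 : ℝ)| := by
  simp only [Wset, Set.mem_ofPred_eq, lt_irrefl, false_and, true_and, false_or]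
  rw [not_and_or, not_le, not_le]


lemma exists_reach_near_axis {p : ℤ × ℤ → ℤ × ℤ → ℝ} {k n₀ : ℕ} {b α R D : ℝ} {x : ℤ × ℤ}
    (hk : 0 < k) (hb : 0 < b) (hα0 : 0 < α) (hαπ : α ≤ Real.pi) (hR : 0 ≤ R)
    (hD : 2 * (n₀ * b) < D) (hx : x ∈ Wset b α) (hxL : n₀ * b + b < znorm x)
    (hxR : α < Real.pi → R + 2 * (n₀ * b) < Real.sin α * (znorm x - R))
    (hmove : ∀ z, ReflTransGen (StepIn p (Wset b α)) x z → ∀ y ∈ axisMoves k,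
      (∀ w, dist w z ≤ n₀ * b → w ∈ Wset b α) →
        ReflTransGen (StepIn p (Wset b α)) x (z + y))
    (hpush : ∀ v, v = Real.cos α ∨ v = -Real.cos α →
      (∀ w, dist w x ≤ R → lin (Real.sin α) v x ≤ lin (Real.sin α) v w → w ∈ Wset b α) →
      ∃ w, ReflTransGen (StepIn p (Wset b α)) x w ∧
        lin (Real.sin α) v x + D ≤ lin (Real.sin α) v w ∧ dist w x ≤ R) :
    ∃ w, ReflTransGen (StepIn p (Wset b α)) x w ∧
      |(w.1 : ℝ) - znorm x| ≤ R + k ∧ |(w.2 : ℝ)| ≤ k := by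
  have hL : 0 ≤ (n₀ : ℝ) * b := by positivity
  have hx1 : (x.1 : ℝ) ≤ znorm x := (le_abs_self _).trans (abs_fst_le_znorm x)
  have hxle := znorm_le_abs_add_abs x
  have hfst : ∀ z : ℤ × ℤ, dist z x ≤ R → (z.1 : ℝ) ≤ znorm x + R := fun z hz => by
    linarith [(abs_le.1 ((abs_fst_sub_le_dist z x).trans hz)).2]
  obtain ⟨σ, hσ, hσx⟩ : ∃ σ : ℝ, (σ = 1 ∨ σ = -1) ∧ σ * x.2 = |(x.2 : ℝ)| := by
    rcases le_total 0 (x.2 : ℝ) with h | h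
    · exact ⟨1, Or.inl rfl, by rw [abs_of_nonneg h, one_mul]⟩
    · exact ⟨-1, Or.inr rfl, by rw [abs_of_nonpos h, neg_one_mul]⟩
  have hσle : ∀ t : ℝ, σ * t ≤ |t| := by
    rcases hσ with rfl | rfl
    · simpa using fun t => le_abs_self t
    · simpa using fun t => neg_le_abs t
  have hv : -(Real.cos α * σ) = Real.cos α ∨ -(Real.cos α * σ) = -Real.cos α := by
    rcases hσ with rfl | rfl <;> simp
  have hlin : ∀ z : ℤ × ℤ, lin (Real.sin α) (-(Real.cos α * σ)) z =
      Real.sin α * z.1 - Real.cos α * (σ * z.2) := fun z => by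
    simp only [lin]
    ring
  specialize hpush _ hv
  simp only [hlin] at hpush
  rw [hσx] at hpush
  rcases hαπ.lt_or_eq with hα | rfl
  · have hs := Real.sin_pos_of_pos_of_lt_pi hα0 hα
    have hs1 := Real.sin_le_one α
    have hc1 := Real.cos_le_one α
    have hc2 := Real.neg_one_le_cos α
    have hW := mem_Wset_iff_of_lt_pi (b := b) hα0 hα
    rw [hW] at hx
    simp only [hW] at hpush
    specialize hxR hα
    have hball : ∀ w : ℤ × ℤ,
        2 * (n₀ * b) < Real.sin α * w.1 - Real.cos α * |(w.2 : ℝ)| →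
        ∀ v, dist v w ≤ n₀ * b → v ∈ Wset b α := by
      intro w hw v hvw
      rw [hW]
      have h1 := (abs_le.1 ((abs_fst_sub_le_dist v w).trans hvw)).1
      have h2 := (abs_abs_sub_abs_le (v.2 : ℝ) w.2).trans
        ((abs_snd_sub_le_dist v w).trans hvw)
      have h3 : |Real.cos α * (|(v.2 : ℝ)| - |(w.2 : ℝ)|)| ≤ n₀ * b := by
        rw [abs_mul]
        nlinarith [abs_nonneg (|(v.2 : ℝ)| - |(w.2 : ℝ)|), abs_le.2 ⟨hc2, hc1⟩]
      have h4 := (abs_le.1 h3).2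
      nlinarith
    rcases le_total (Real.cos α) 0 with hc | hc
    · have hge : ∀ z : ℤ × ℤ, Real.sin α * z.1 - Real.cos α * (σ * z.2) ≤
          Real.sin α * z.1 - Real.cos α * |(z.2 : ℝ)| := fun z => by
        nlinarith [hσle z.2]
      obtain ⟨z, hz, hzl, hzd⟩ := hpush fun w _ hw => by linarith [hge w]
      refine exists_reach_axis_right_first hk hmove hz hR (hfst z hzd) ?_ ?_
      · intro w hw2 hw1
        refine hball w ?_
        rw [hw2]
        have : (z.1 : ℝ) ≤ w.1 := by exact_mod_cast hw1
        nlinarith [hge z]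
      · intro w hw v hvw
        rw [hW]
        have h1 := (abs_le.1 ((abs_fst_sub_le_dist v w).trans hvw)).1
        have h2 : 0 < Real.sin α * v.1 := mul_pos hs (by linarith)
        nlinarith [abs_nonneg (v.2 : ℝ)]
    · obtain ⟨z, hz, hzl, hzd⟩ : ∃ z, ReflTransGen (StepIn p (Wset b α)) x z ∧
          2 * (n₀ * b) < Real.sin α * z.1 - Real.cos α * |(z.2 : ℝ)| ∧ dist z x ≤ R := by
        by_cases hx2 : |(x.2 : ℝ)| ≤ R
        · refine ⟨x, .refl, ?_, by simpa using hR⟩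
          have hx1' : 0 < (x.1 : ℝ) := by
            refine pos_of_mul_pos_right (lt_of_le_of_lt ?_ (sub_pos.1 hx)) hs.le
            positivity
          rw [abs_of_pos hx1'] at hxle
          have : Real.sin α * (znorm x - R) ≤ Real.sin α * x.1 := by
            gcongr
            linarith
          nlinarith [abs_nonneg (x.2 : ℝ)]
        · push Not at hx2
          have heq : ∀ w : ℤ × ℤ, dist w x ≤ R → σ * w.2 = |(w.2 : ℝ)| := by
            intro w hw
            have h := abs_le.1 ((abs_snd_sub_le_dist w x).trans hw)
            rcases hσ with rfl | rfl
            · rw [abs_of_nonneg (by linarith), one_mul]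
            · rw [abs_of_nonpos (by linarith), neg_one_mul]
          obtain ⟨z, hz, hzl, hzd⟩ := hpush fun w hw hwl => by
            rw [heq w hw] at hwl
            linarith
          rw [heq z hzd] at hzl
          exact ⟨z, hz, by linarith, hzd⟩
      refine exists_reach_axis_vertical_first hk hmove hz hR (hfst z hzd) ?_
      intro w hw1 hw2
      refine hball w ?_
      have h1 : (z.1 : ℝ) ≤ w.1 := by exact_mod_cast hw1
      have h2 : |(w.2 : ℝ)| ≤ |(z.2 : ℝ)| := by exact_mod_cast hw2
      nlinarith
  · have hW := mem_Wset_pi_iff (b := b)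
    rw [hW] at hx
    simp only [hW, Real.sin_pi, Real.cos_pi, zero_mul, zero_sub, neg_mul, one_mul, neg_neg]
      at hpush
    obtain ⟨z, hz, hzl, hzd⟩ : ∃ z, ReflTransGen (StepIn p (Wset b Real.pi)) x z ∧
        (n₀ * b < z.1 ∨ n₀ * b + b < |(z.2 : ℝ)|) ∧ dist z x ≤ R := by
      by_cases hx2 : b < |(x.2 : ℝ)|
      · obtain ⟨z, hz, hzl, hzd⟩ := hpush fun w _ hw =>
          Or.inr (hx2.trans_le (hw.trans (hσle _)))
        exact ⟨z, hz, Or.inr (by linarith [hσle z.2]), hzd⟩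
      · have hx0 := hx.resolve_right hx2
        rw [abs_of_pos hx0] at hxle
        exact ⟨x, .refl, Or.inl (by linarith), by simpa using hR⟩
    refine exists_reach_axis_right_first hk hmove hz hR (hfst z hzd) ?_ ?_
    · intro w hw2 hw1 v hvw
      rw [hW]
      refine hzl.imp (fun h => ?_) fun h => ?_
      · have h1 := (abs_le.1 ((abs_fst_sub_le_dist v w).trans hvw)).1
        have : (z.1 : ℝ) ≤ w.1 := by exact_mod_cast hw1
        linarith
      · have h2 := abs_le.1 ((abs_abs_sub_abs_le (v.2 : ℝ) w.2).trans
          ((abs_snd_sub_le_dist v w).trans hvw))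
        rw [hw2] at h2
        linarith
    · intro w hw v hvw
      rw [hW]
      have h1 := (abs_le.1 ((abs_fst_sub_le_dist v w).trans hvw)).1
      exact Or.inl (by linarith)

/-- Lemma 4.8: under (A1), (A2) and `‖μ(x)‖ → 0` as `‖x‖ → ∞`,
for `α ∈ (0,π]` there are `ε, A, C ∈ (0,∞)` such that from any `x ∈ W(α)` with
`‖x‖ ≥ A`, the walk hits the closed ball `B_C((ε‖x‖,0))` before leaving `W(α)` with
positive probability. -/
theorem hits_ball_before_leaving_wedge
    {Ω : Type*} [MeasurableSpace Ω] (P : Measure Ω) [IsProbabilityMeasure P]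
    (S : Set (ℤ × ℤ)) (hSunb : ∀ R : ℝ, ∃ x ∈ S, R < znorm x)
    (ξ : ℕ → Ω → ℤ × ℤ) (hmeas : ∀ t, Measurable (ξ t))
    (hinS : ∀ t, ∀ᵐ ω ∂P, ξ t ω ∈ S)
    (p : ℤ × ℤ → ℤ × ℤ → ℝ) (hpmf : IsJumpPMF p)
    (hMarkov : IsMarkovWith P ξ p)
    (κ : ℝ) (k n₀ : ℕ) (hκ : 0 < κ) (hk : 0 < k) (hn₀ : 0 < n₀)
    (hA1 : A1 P S ξ κ k n₀)
    (b : ℝ) (hb : 0 < b) (hA2 : A2 p b)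
    (hdrift : ∀ δ : ℝ, 0 < δ → ∃ r₁ : ℝ, ∀ x ∈ S, r₁ ≤ znorm x → muNorm p x ≤ δ)
    (α : ℝ) (hα0 : 0 < α) (hαπ : α ≤ Real.pi) :
    ∃ ε A C : ℝ, 0 < ε ∧ 0 < A ∧ 0 < C ∧
      ∀ x ∈ Wset b α, A ≤ znorm x → P {ω | ξ 0 ω = x} ≠ 0 →
        0 < P ({ω | ∃ t : ℕ,
              Real.sqrt (((ξ t ω).1 - ε * znorm x) ^ 2 + ((ξ t ω).2 : ℝ) ^ 2) ≤ C ∧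
              ∀ s ≤ t, ξ s ω ∈ Wset b α} ∩
            {ω | ξ 0 ω = x}) := by
  obtain ⟨B, hB'⟩ := exists_finset_znorm_le b
  have hB : ∀ z, ∀ d ∉ B, p z d = 0 := fun z d hd =>
    hA2 z d (not_le.1 fun h => hd (hB' d h))
  obtain ⟨c₁, hc₁, hBc₁⟩ := exists_pos_le_abs_lin B (Real.sin α) (Real.cos α)
  obtain ⟨c₂, hc₂, hBc₂⟩ := exists_pos_le_abs_lin B (Real.sin α) (-Real.cos α)
  obtain ⟨c, hc, hcc₁, hcc₂⟩ : ∃ c, 0 < c ∧ c ≤ c₁ ∧ c ≤ c₂ :=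
    ⟨min c₁ c₂, lt_min hc₁ hc₂, min_le_left _ _, min_le_right _ _⟩
  obtain ⟨η, hη, hηκ⟩ : ∃ η : ℝ, 0 < η ∧ n₀ * (B.card * η) < κ := by
    have hq : (0 : ℝ) < n₀ * B.card + 1 := by positivity
    refine ⟨κ / (n₀ * B.card + 1), by positivity, ?_⟩
    rw [← mul_assoc, mul_div_assoc', div_lt_iff₀ hq]
    linarith
  obtain ⟨r, hr⟩ := hdrift (η * c / 4) (by positivity)
  obtain ⟨N, hN⟩ := exists_nat_gt (2 * (n₀ * b) / c)
  rw [div_lt_iff₀ hc] at hN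
  set R : ℝ := N * (n₀ * b) with hRdef
  have hR : 0 ≤ R := by positivity
  have hL : 0 ≤ (n₀ : ℝ) * b := by positivity
  have hs0 := Real.sin_nonneg_of_nonneg_of_le_pi hα0.le hαπ
  have hquot : 0 ≤ (R + 2 * (n₀ * b)) / Real.sin α := by positivity
  refine ⟨1, |r| + 2 * R + (n₀ * b) + b + 1 + (R + 2 * (n₀ * b)) / Real.sin α, R + 2 * k + 1,
    one_pos, by positivity, by positivity, ?_⟩
  intro x hx hxA hx0
  have hr0 := abs_nonneg r
  have hSmem : ∀ t z, P {ω | ξ t ω = z} ≠ 0 → z ∈ S := by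
    intro t z hz
    by_contra hzS
    refine hz (measure_mono_null ?_ (ae_iff.1 (hinS t)))
    intro ω hω
    have hω' : ξ t ω = z := hω
    simpa [hω'] using hzS
  have htime : ∀ z, ReflTransGen (StepIn p (Wset b α)) x z → ∃ t, P {ω | ξ t ω = z} ≠ 0 := by
    intro z hz
    obtain ⟨t, ht⟩ := exists_time_measure_ne_zero hMarkov hx0 hx hz
    exact ⟨t, fun h => ht (measure_mono_null Set.inter_subset_right h)⟩
  have hpath : ∀ z, ReflTransGen (StepIn p (Wset b α)) x z → ∀ y ∈ axisMoves k,
      ∃ f : ℕ → ℤ × ℤ, f 0 = z ∧ f n₀ = z + y ∧ ∀ i < n₀, η < p (f i) (f (i + 1) - f i) := by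
    intro z hz y hy
    obtain ⟨t, ht⟩ := htime z hz
    exact exists_likely_path hMarkov hmeas hA1 hB hη.le hηκ (hSmem t z ht) ht hy
  have hdr : ∀ z, ReflTransGen (StepIn p (Wset b α)) x z → r ≤ znorm z →
      muNorm p z ≤ η * c / 4 := by
    intro z hz hrz
    obtain ⟨t, ht⟩ := htime z hz
    exact hr z (hSmem t z ht) hrz
  have hfar : ∀ w, dist w x ≤ N * (n₀ * b) → r ≤ znorm w := by
    intro w hw
    have := znorm_le_znorm_add_dist x w
    rw [dist_comm] at this
    linarith [le_abs_self r]
  have hk' : (k : ℝ) ≠ 0 := by exact_mod_cast hk.ne'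
  have hne : ∀ v, v = Real.cos α ∨ v = -Real.cos α →
      ∃ y ∈ axisMoves k, lin (Real.sin α) v y ≠ 0 := by
    intro v hv
    by_cases hs : Real.sin α = 0
    · refine ⟨(0, (k : ℤ)), by simp [axisMoves], ?_⟩
      have hcos : Real.cos α ≠ 0 := fun h => by
        have := Real.sin_sq_add_cos_sq α
        rw [hs, h] at this
        norm_num at this
      rcases hv with rfl | rfl <;> simp [lin, hcos, hk']
    · exact ⟨((k : ℤ), 0), by simp [axisMoves], by simp [lin, hs, hk']⟩
  obtain ⟨w, hw, hw1, hw2⟩ := exists_reach_near_axis (p := p) (n₀ := n₀) (R := R) (D := N * c)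
    hk hb hα0 hαπ hR hN hx (by linarith)
    (fun hα => by
      have hs := Real.sin_pos_of_pos_of_lt_pi hα0 hα
      have : (R + 2 * (n₀ * b)) / Real.sin α < znorm x - R := by linarith
      rwa [div_lt_iff₀' hs] at this)
    (fun z hz y hy hW => reach_add_of_closedBall_subset hb.le hA2 hη.le hpath hz hy hW)
    (fun v hv hW => by
      refine exists_reach_lin_add_mul_le hpmf hB hb.le hA2 hη.le hpath hdr
        (Real.abs_sin_le_one α) ?_ hc.le (by linarith [mul_pos hη hc]) ?_ (hne v hv) N hW hfar
      · rcases hv with rfl | rfl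
        · exact Real.abs_cos_le_one α
        · rw [abs_neg]
          exact Real.abs_cos_le_one α
      · intro y hy hy0
        rcases hv with rfl | rfl
        · exact hcc₁.trans (hBc₁ y hy hy0)
        · exact hcc₂.trans (hBc₂ y hy hy0))
  obtain ⟨t, ht⟩ := exists_time_measure_ne_zero hMarkov hx0 hx hw
  refine (pos_iff_ne_zero.2 ht).trans_le (measure_mono ?_)
  rintro ω ⟨⟨h1, h2⟩, h3⟩
  refine ⟨⟨t, ?_, h1⟩, h2⟩
  have h3' : ξ t ω = w := h3
  rw [h3', one_mul]
  refine (Real.sqrt_le_sqrt ?_).trans ((Real.sqrt_sq (by positivity :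
    0 ≤ |(w.1 : ℝ) - znorm x| + |(w.2 : ℝ)|)).le.trans (by linarith))
  rw [add_sq, sq_abs, sq_abs]
  have := mul_nonneg (abs_nonneg ((w.1 : ℝ) - znorm x)) (abs_nonneg (w.2 : ℝ))
  linarith
end

section
/- Suppose (A2) and (sub2) hold. Let α ∈ (0,π], w = π/(2α), and γ > 1, and define f̂_w(x) = f_w(x)·1_{x ∈ W(α)}. Then there exists A ∈ (0,∞) such that for all x ∈ W(α) ∩ S with ‖x‖ > A, E[f̂_w(ξ_{t+1})^γ − f̂_w(ξ_t)^γ | ξ_t = x] ≥ 0. -/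
open MeasureTheory
open scoped ENNReal

theorem exists_quadratic_gain_posPart_rpow {γ : ℝ} (hγ : 1 < γ) :
    ∃ c : ℝ, 0 < c ∧ ∀ u d : ℝ, 0 < u → u ≤ 1 → |d| ≤ 1 →
      u ^ γ + u ^ (γ - 1) * (γ * d + c * d ^ 2) ≤ max (u + d) 0 ^ γ := by
  suffices H : ∃ c : ℝ, 0 < c ∧ c ≤ γ - 1 ∧ ∀ u d : ℝ, 0 < u → u ≤ 1 → |d| ≤ 1 →
      0 < u + d → u + γ * d + c * d ^ 2 ≤ u * ((u + d) / u) ^ γ by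
    obtain ⟨c, hc, hcγ, H⟩ := H
    refine ⟨c, hc, fun u d hu hu1 hd => ?_⟩
    have hpow : u ^ γ = u ^ (γ - 1) * u := by
      rw [← Real.rpow_add_one hu.ne', sub_add_cancel]
    have hpos : 0 < u ^ (γ - 1) := Real.rpow_pos_of_pos hu _
    rcases lt_or_ge 0 (u + d) with h | h
    · have e : u + d = u * ((u + d) / u) := by field_simp
      rw [max_eq_left h.le, e, Real.mul_rpow hu.le (by positivity), hpow]
      have := mul_le_mul_of_nonneg_left (H u d hu hu1 hd h) hpos.le
      linarith
    · rw [max_eq_right h, Real.zero_rpow (by linarith), hpow]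
      have hd0 : d < 0 := by linarith
      rw [abs_of_neg hd0] at hd
      have hd2 : c * d ^ 2 ≤ c * -d := mul_le_mul_of_nonneg_left (by nlinarith) hc.le
      have : u + (γ * d + c * d ^ 2) ≤ 0 := by nlinarith
      nlinarith
  rcases le_total γ 2 with h2 | h2
  · refine ⟨(γ - 1) ^ 2 / 2, by have : 0 < γ - 1 := by linarith
                                positivity, by nlinarith, fun u d hu hu1 hd h => ?_⟩
    obtain ⟨hd1, hd2⟩ := abs_le.1 hd
    set v := (u + d) / u with hv
    have hv0 : 0 < v := by positivity
    have hQ : 0 < u + (2 - γ) * d := by nlinarith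
    have hQ2 : u + (2 - γ) * d ≤ 2 := by nlinarith
    have hB := rpow_one_add_le_one_add_mul_self (s := v⁻¹ - 1) (p := γ - 1)
      (by have := inv_pos.2 hv0; linarith) (by linarith) (by linarith)
    rw [add_sub_cancel, Real.inv_rpow hv0.le] at hB
    have hvp : 0 < v ^ (γ - 1) := Real.rpow_pos_of_pos hv0 _
    have e1 : 1 + (γ - 1) * (v⁻¹ - 1) = (u + (2 - γ) * d) / (u + d) := by
      rw [hv]; field_simp; ring
    rw [e1, inv_le_iff_one_le_mul₀ hvp] at hB
    have hB' : (u + d) / (u + (2 - γ) * d) ≤ v ^ (γ - 1) := by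
      rw [div_le_iff₀ hQ]
      rw [div_mul_eq_mul_div, le_div_iff₀ h] at hB
      linarith
    have e2 : u * v ^ γ = (u + d) * v ^ (γ - 1) := by
      rw [← sub_add_cancel γ 1, Real.rpow_add_one hv0.ne', sub_add_cancel]
      rw [hv]; field_simp
    rw [e2]
    refine le_trans ?_ (mul_le_mul_of_nonneg_left hB' h.le)
    rw [mul_div_assoc', le_div_iff₀ hQ]
    have : 0 ≤ (γ - 1) ^ 2 * d ^ 2 := by positivity
    nlinarith
  · refine ⟨1 / 2, by norm_num, by linarith, fun u d hu hu1 hd h => ?_⟩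
    set e := d / u with he
    have hde : d = u * e := by rw [he]; field_simp
    have hv : (u + d) / u = 1 + e := by rw [he]; field_simp
    have hv0 : 0 < 1 + e := by rw [← hv]; positivity
    have hB := one_add_mul_self_le_rpow_one_add (s := (1 + e) ^ 2 - 1) (p := γ / 2)
      (by nlinarith [sq_nonneg (1 + e)]) (by linarith)
    rw [add_sub_cancel, ← Real.rpow_natCast, ← Real.rpow_mul hv0.le] at hB
    have e3 : ((2 : ℕ) : ℝ) * (γ / 2) = γ := by push_cast; ring
    rw [e3] at hB
    push_cast [Real.rpow_two] at hB
    rw [hv]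
    have := mul_le_mul_of_nonneg_left hB hu.le
    refine le_trans ?_ this
    rw [hde]
    have h5 : u ^ 2 * e ^ 2 ≤ u * e ^ 2 :=
      mul_le_mul_of_nonneg_right (by nlinarith) (sq_nonneg e)
    have h6 : 0 ≤ u * e ^ 2 := by positivity
    nlinarith

theorem exists_norm_one_add_cpow_taylor_le (w : ℂ) :
    ∃ K δ : ℝ, 0 ≤ K ∧ 0 < δ ∧ ∀ z : ℂ, ‖z‖ < δ →
      ‖(1 + z) ^ w - 1 - (w * z + w * (w - 1) / 2 * z ^ 2)‖ ≤ K * ‖z‖ ^ 3 := by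
  have h := (Complex.one_add_cpow_hasFPowerSeriesAt_zero (a := w)).isBigO_sub_partialSum_pow 3
  obtain ⟨K, hK, h⟩ := h.exists_pos
  rw [Asymptotics.isBigOWith_iff, Metric.eventually_nhds_iff] at h
  obtain ⟨δ, hδ, h⟩ := h
  refine ⟨K, δ, hK.le, hδ, fun z hz => ?_⟩
  have := h (y := z) (by simpa using hz)
  rw [norm_pow, norm_norm] at this
  have e : (binomialSeries ℂ w).partialSum 3 z = 1 + (w * z + w * (w - 1) / 2 * z ^ 2) := by
    have h2 : (2 : ℂ) * Ring.choose w 2 = w * (w - 1) := by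
      have := Ring.descPochhammer_eq_factorial_smul_choose w 2
      simp [descPochhammer_succ_right, Polynomial.smeval_mul, Polynomial.smeval_sub,
        Polynomial.smeval_X, Polynomial.smeval_one] at this
      linear_combination -this
    simp only [FormalMultilinearSeries.partialSum, Finset.sum_range_succ, Finset.sum_range_zero,
      binomialSeries, FormalMultilinearSeries.ofScalars_apply_eq]
    simp only [Ring.choose_zero_right, Ring.choose_one_right, smul_eq_mul]
    linear_combination (z ^ 2 / 2) * h2
  rw [e, zero_add] at this
  rwa [sub_sub]

/-- The lattice point `x ∈ ℤ²` as a complex number. -/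
def toComplex (x : ℤ × ℤ) : ℂ := ⟨(x.1 : ℝ), (x.2 : ℝ)⟩

theorem toComplex_add (x y : ℤ × ℤ) : toComplex (x + y) = toComplex x + toComplex y := by
  apply Complex.ext <;> simp [toComplex]

theorem norm_toComplex (x : ℤ × ℤ) : ‖toComplex x‖ = znorm x := by
  rw [Complex.norm_eq_sqrt_sq_add_sq]; rfl

theorem indicator_fw_nonneg {α w : ℝ} (hα : 0 < α) (hw : w = Real.pi / (2 * α)) (x : ℤ × ℤ) :
    0 ≤ (WsetArg α).indicator (fw w) x := by
  refine Set.indicator_nonneg (fun x hx => ?_) x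
  have hwα : w * α = Real.pi / 2 := by rw [hw]; field_simp
  have hw0 : 0 < w := by rw [hw]; positivity
  obtain ⟨-, h1, h2⟩ := hx
  refine mul_nonneg (Real.rpow_nonneg (Real.sqrt_nonneg _) _) (Real.cos_nonneg_of_mem_Icc ⟨?_, ?_⟩)
  · nlinarith
  · nlinarith

theorem re_exp_mul_cpow_ofReal (φ w : ℝ) (z : ℂ) :
    (Complex.exp (φ * Complex.I) * z ^ (w : ℂ)).re = ‖z‖ ^ w * Real.cos (φ + w * z.arg) := by
  have : Complex.exp (φ * Complex.I) * z ^ (w : ℂ) =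
      ((‖z‖ ^ w : ℝ) : ℂ) * Complex.exp ((φ + w * z.arg : ℝ) * Complex.I) := by
    rw [Complex.cpow_ofReal, Complex.ofReal_add, add_mul, Complex.exp_add,
      Complex.exp_mul_I ((w * z.arg : ℝ) : ℂ), mul_comm w]
    push_cast
    ring
  rw [this, Complex.re_ofReal_mul, Complex.exp_ofReal_mul_I_re]

/-- Near `x`, the truncated harmonic function dominates the positive part of the harmonic branch
through `x`, also when the jump crosses the slit of the wedge with `α = π`. -/
theorem exists_posPart_branch_le_indicator_fw {α w : ℝ} (hα0 : 0 < α) (hαπ : α ≤ Real.pi)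
    (hw : w = Real.pi / (2 * α)) :
    ∃ δ : ℝ, 0 < δ ∧ ∀ x y : ℤ × ℤ, x ∈ WsetArg α → ‖toComplex y / toComplex x‖ < δ →
      znorm x ^ w * max (Complex.exp ((w * ang x : ℝ) * Complex.I) *
        (1 + toComplex y / toComplex x) ^ (w : ℂ)).re 0 ≤ (WsetArg α).indicator (fw w) (x + y) := by
  have hwα : w * α = Real.pi / 2 := by rw [hw]; field_simp
  have hw0 : 0 < w := by rw [hw]; positivity
  have hcont : ContinuousAt (fun z : ℂ => Complex.arg (1 + z)) 0 :=
    ContinuousAt.comp (g := Complex.arg) (Complex.continuousAt_arg (by simp)) (by fun_prop)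
  obtain ⟨δ, hδ, H⟩ := Metric.continuousAt_iff.1 hcont α hα0
  refine ⟨min δ 1, by positivity, fun x y hx hz => ?_⟩
  set z := toComplex y / toComplex x with hzdef
  have hψ := H (x := z) (by simpa using hz.trans_le (min_le_left _ _))
  simp only [add_zero, Complex.arg_one, Real.dist_eq, sub_zero] at hψ
  have hz1 : ‖z‖ < 1 := hz.trans_le (min_le_right _ _)
  have h1z : 1 + z ≠ 0 := by
    intro h
    rw [eq_neg_of_add_eq_zero_right h] at hz1
    simp at hz1
  obtain ⟨hr, hx1, hx2⟩ := hx
  have hX : toComplex x ≠ 0 := by rw [← norm_pos_iff, norm_toComplex]; exact hr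
  have hXY : toComplex (x + y) = toComplex x * (1 + z) := by
    rw [toComplex_add, hzdef]; field_simp
  rw [re_exp_mul_cpow_ofReal, ← mul_add]
  obtain ⟨hψ1, hψ2⟩ := abs_lt.1 hψ
  set ψ := (1 + z).arg
  by_cases hin : |ang x + ψ| < α
  · obtain ⟨h1, h2⟩ := abs_lt.1 hin
    have harg : ang (x + y) = ang x + ψ := by
      change (toComplex (x + y)).arg = _
      rw [hXY]
      exact (Complex.arg_mul_eq_add_arg_iff hX h1z).2
        ⟨(neg_le_neg hαπ).trans_lt h1, h2.le.trans hαπ⟩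
    have hnorm : znorm (x + y) = znorm x * ‖1 + z‖ := by
      rw [← norm_toComplex, hXY, norm_mul, norm_toComplex]
    have hmem : x + y ∈ WsetArg α :=
      ⟨by rw [hnorm]; exact mul_pos hr (norm_pos_iff.2 h1z), by rw [harg]; exact h1,
        by rw [harg]; exact h2⟩
    rw [Set.indicator_of_mem hmem, max_eq_left, fw, harg, hnorm,
      Real.mul_rpow hr.le (norm_nonneg _), mul_assoc]
    exact mul_nonneg (Real.rpow_nonneg (norm_nonneg _) _)
      (Real.cos_nonneg_of_mem_Icc ⟨by nlinarith, by nlinarith⟩)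
  · have hcos : Real.cos (w * (ang x + ψ)) ≤ 0 := by
      rw [← Real.cos_abs, abs_mul, abs_of_pos hw0]
      have h3 : |ang x + ψ| ≤ α + α := (abs_add_le _ _).trans
        (add_le_add (abs_lt.2 ⟨hx1, hx2⟩).le hψ.le)
      rw [not_lt] at hin
      exact Real.cos_nonpos_of_pi_div_two_le_of_le (by nlinarith)
        (by nlinarith [Real.pi_pos])
    rw [max_eq_right (mul_nonpos_of_nonneg_of_nonpos (Real.rpow_nonneg (norm_nonneg _) _) hcos),
      mul_zero]
    exact indicator_fw_nonneg hα0 hw _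

/-- Second-order lower bound for the `γ`-th power of the positive part of `Re (a (1 + z) ^ w)`. -/
theorem exists_posPart_branch_rpow_lower_bound (w : ℝ) {γ : ℝ} (hγ : 1 < γ) :
    ∃ c K δ : ℝ, 0 < c ∧ 0 ≤ K ∧ 0 < δ ∧ ∀ a z : ℂ, ‖a‖ = 1 → 0 < a.re → ‖z‖ < δ →
      a.re ^ γ + a.re ^ (γ - 1) * (γ * ((a * (w * z)).re + (a * (w * (w - 1) / 2 * z ^ 2)).re) +
        c * (a * (w * z)).re ^ 2 - K * ‖z‖ ^ 3) ≤ max (a * (1 + z) ^ (w : ℂ)).re 0 ^ γ := by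
  obtain ⟨c, hc, hgain⟩ := exists_quadratic_gain_posPart_rpow hγ
  obtain ⟨K, δ, hK, hδ, htaylor⟩ := exists_norm_one_add_cpow_taylor_le (w : ℂ)
  set T : ℝ := ‖(w * (w - 1) / 2 : ℂ)‖ with hT
  have hT0 : 0 ≤ T := norm_nonneg _
  set L := |w| + T + K + 1 with hL
  have hw0 : 0 ≤ |w| := abs_nonneg w
  have hL0 : 0 < L := by positivity
  refine ⟨c, γ * K + 2 * c * |w| * (T + K), min δ (min 1 L⁻¹), hc, by positivity, by positivity,
    fun a z ha hre hz => ?_⟩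
  have hz1 : ‖z‖ ≤ 1 := (hz.trans_le ((min_le_right _ _).trans (min_le_left _ _))).le
  have hzL : ‖z‖ ≤ L⁻¹ := (hz.trans_le ((min_le_right _ _).trans (min_le_right _ _))).le
  have hbound : ∀ v : ℂ, |(a * v).re| ≤ ‖v‖ := fun v =>
    (Complex.abs_re_le_norm _).trans_eq (by rw [norm_mul, ha, one_mul])
  have hl := hbound (w * z)
  have ht := hbound (w * (w - 1) / 2 * z ^ 2)
  have hρ := (hbound _).trans (htaylor z (hz.trans_le (min_le_left _ _)))
  rw [norm_mul, Complex.norm_real, Real.norm_eq_abs] at hl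
  rw [norm_mul, ← hT, norm_pow] at ht
  set n := ‖z‖
  have hn0 : 0 ≤ n := norm_nonneg z
  set l := (a * (w * z)).re
  set t := (a * (w * (w - 1) / 2 * z ^ 2)).re
  set d := (a * (1 + z) ^ (w : ℂ)).re - a.re with hd
  have hρ' : |d - l - t| ≤ K * n ^ 3 := by
    rw [mul_sub, mul_sub, mul_add, Complex.sub_re, Complex.sub_re, Complex.add_re, mul_one] at hρ
    rwa [sub_sub]
  have hn2 : n ^ 2 ≤ n := by nlinarith
  have hn3 : n ^ 3 ≤ n ^ 2 := by nlinarith [mul_nonneg hn0 hn0]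
  have hm : |d - l| ≤ (T + K) * n ^ 2 := by
    have h1 : |d - l| ≤ |d - l - t| + |t| := by simpa using abs_add_le (d - l - t) t
    nlinarith
  have hd1 : |d| ≤ 1 := by
    have h1 : |d| ≤ |d - l| + |l| := by simpa using abs_add_le (d - l) l
    have h2 : L * n ≤ 1 := by
      calc L * n ≤ L * L⁻¹ := by gcongr
        _ = 1 := mul_inv_cancel₀ hL0.ne'
    nlinarith
  have hu1 : a.re ≤ 1 := (Complex.re_le_norm a).trans ha.le
  have key := hgain a.re d hre hu1 hd1
  rw [hd, add_sub_cancel, ← hd] at key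
  refine le_trans ?_ key
  gcongr _ + _ * ?_
  have h1 : γ * (l + t) - γ * K * n ^ 3 ≤ γ * d := by
    nlinarith [(abs_le.1 hρ').1]
  have h2 : l ^ 2 - 2 * |w| * (T + K) * n ^ 3 ≤ d ^ 2 := by
    have h3 : |l| * |d - l| ≤ |w| * n * ((T + K) * n ^ 2) := by gcongr
    rw [← abs_mul] at h3
    nlinarith [(abs_le.1 h3).1, sq_nonneg (d - l)]
  nlinarith

theorem exists_finset_jump_support {p : ℤ × ℤ → ℤ × ℤ → ℝ} {b : ℝ} (hA2 : A2 p b) :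
    ∃ F : Finset (ℤ × ℤ), ∀ x, ∀ y ∉ F, p x y = 0 := by
  refine ⟨Finset.Icc (-⌈b⌉) ⌈b⌉ ×ˢ Finset.Icc (-⌈b⌉) ⌈b⌉, fun x y hy => hA2 x y ?_⟩
  by_contra! h
  have h1 : |(y.1 : ℝ)| ≤ ⌈b⌉ :=
    ((Complex.abs_re_le_norm (toComplex y)).trans_eq (norm_toComplex y)).trans
      (h.trans (Int.le_ceil b))
  have h2 : |(y.2 : ℝ)| ≤ ⌈b⌉ :=
    ((Complex.abs_im_le_norm (toComplex y)).trans_eq (norm_toComplex y)).trans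
      (h.trans (Int.le_ceil b))
  refine hy (Finset.mem_product.2 ⟨Finset.mem_Icc.2 ?_, Finset.mem_Icc.2 ?_⟩)
  · exact abs_le.1 (by exact_mod_cast h1)
  · exact abs_le.1 (by exact_mod_cast h2)

section moments

variable {p : ℤ × ℤ → ℤ × ℤ → ℝ} {F : Finset (ℤ × ℤ)} {x : ℤ × ℤ}

theorem tsum_jump_eq_sum (hF : ∀ x, ∀ y ∉ F, p x y = 0) (x : ℤ × ℤ) (g : ℤ × ℤ → ℝ) :
    ∑' y, p x y * g y = ∑ y ∈ F, p x y * g y :=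
  tsum_eq_sum fun y hy => by rw [hF x y hy, zero_mul]

theorem abs_sum_re_mul_le (hF : ∀ x, ∀ y ∉ F, p x y = 0) (x : ℤ × ℤ) (q : ℂ) :
    |∑ y ∈ F, p x y * (q * toComplex y).re| ≤ ‖q‖ * muNorm p x := by
  have e : ∑ y ∈ F, p x y * (q * toComplex y).re = (q * ⟨mu1 p x, mu2 p x⟩).re := by
    rw [mu1, mu2, tsum_jump_eq_sum hF, tsum_jump_eq_sum hF, Complex.mul_re, Finset.mul_sum,
      Finset.mul_sum, ← Finset.sum_sub_distrib]
    refine Finset.sum_congr rfl fun y _ => ?_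
    simp only [toComplex, Complex.mul_re]
    ring
  rw [e]
  refine (Complex.abs_re_le_norm _).trans_eq ?_
  rw [norm_mul, Complex.norm_eq_sqrt_sq_add_sq ⟨mu1 p x, mu2 p x⟩]
  rfl

theorem abs_sum_re_mul_sq_le (hF : ∀ x, ∀ y ∉ F, p x y = 0) (x : ℤ × ℤ) (s : ℂ) :
    |∑ y ∈ F, p x y * (s * toComplex y ^ 2).re| ≤ ‖s‖ * (|M11 p x - M22 p x| + 2 * |M12 p x|) := by
  have e : ∑ y ∈ F, p x y * (s * toComplex y ^ 2).re =
      (s * ⟨M11 p x - M22 p x, 2 * M12 p x⟩).re := by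
    rw [M11, M22, M12, tsum_jump_eq_sum hF, tsum_jump_eq_sum hF, tsum_jump_eq_sum hF,
      Complex.mul_re]
    simp only [mul_sub, Finset.mul_sum, ← Finset.sum_sub_distrib]
    refine Finset.sum_congr rfl fun y _ => ?_
    simp only [toComplex, pow_two, Complex.mul_re, Complex.mul_im]
    ring
  rw [e]
  refine (Complex.abs_re_le_norm _).trans ?_
  rw [norm_mul]
  gcongr
  refine (Complex.norm_le_abs_re_add_abs_im _).trans_eq ?_
  simp [abs_mul]

theorem le_sum_re_mul_sq {σ2 ε : ℝ} (hF : ∀ x, ∀ y ∉ F, p x y = 0) (h11 : |M11 p x - σ2| ≤ ε)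
    (h22 : |M22 p x - σ2| ≤ ε) (h12 : |M12 p x| ≤ ε) (q : ℂ) :
    ‖q‖ ^ 2 * (σ2 - 2 * ε) ≤ ∑ y ∈ F, p x y * (q * toComplex y).re ^ 2 := by
  have e : ∑ y ∈ F, p x y * (q * toComplex y).re ^ 2 =
      q.re ^ 2 * M11 p x - 2 * q.re * q.im * M12 p x + q.im ^ 2 * M22 p x := by
    rw [M11, M22, M12, tsum_jump_eq_sum hF, tsum_jump_eq_sum hF, tsum_jump_eq_sum hF]
    simp only [Finset.mul_sum, ← Finset.sum_sub_distrib, ← Finset.sum_add_distrib]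
    refine Finset.sum_congr rfl fun y _ => ?_
    simp only [toComplex, Complex.mul_re]
    ring
  rw [e, Complex.sq_norm, Complex.normSq_apply]
  obtain ⟨h11, -⟩ := abs_le.1 h11
  obtain ⟨h22, -⟩ := abs_le.1 h22
  have h4 : 2 * q.re * q.im * M12 p x ≤ (q.re ^ 2 + q.im ^ 2) * ε := by
    calc 2 * q.re * q.im * M12 p x ≤ |2 * q.re * q.im| * |M12 p x| := by
          rw [← abs_mul]; exact le_abs_self _
      _ ≤ (q.re ^ 2 + q.im ^ 2) * ε := by
          gcongr
          exact abs_le.2 ⟨by nlinarith [sq_nonneg (q.re + q.im)],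
            by nlinarith [sq_nonneg (q.re - q.im)]⟩
  nlinarith [sq_nonneg q.re, sq_nonneg q.im]

end moments

/-- Lemma 5.4: under (A2) and (sub2), for `α ∈ (0,π]`,
`w = π/(2α)` and `γ > 1`, the process `f̂_w(ξ_t)^γ` (with `f̂_w = f_w·1_{W(α)}`) is a
submartingale far from the origin: the conditional mean increment, expressed through
the jump law `p`, is nonnegative for all `x ∈ W(α) ∩ S` with `‖x‖` large. -/
theorem fhat_pow_submartingale
    (S : Set (ℤ × ℤ)) (hSunb : ∀ R : ℝ, ∃ x ∈ S, R < znorm x)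
    (p : ℤ × ℤ → ℤ × ℤ → ℝ) (hpmf : IsJumpPMF p)
    (b : ℝ) (hb : 0 < b) (hA2 : A2 p b)
    (σ2 : ℝ) (hσ : 0 < σ2)
    (hsub2 : ∀ ε : ℝ, 0 < ε → ∃ r₁ : ℝ, ∀ x ∈ S, r₁ ≤ znorm x →
      znorm x * muNorm p x ≤ ε ∧ |M11 p x - σ2| ≤ ε ∧ |M22 p x - σ2| ≤ ε ∧ |M12 p x| ≤ ε)
    (α : ℝ) (hα0 : 0 < α) (hαπ : α ≤ Real.pi)
    (w γ : ℝ) (hw : w = Real.pi / (2 * α)) (hγ : 1 < γ) :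
    ∃ A : ℝ, 0 < A ∧ ∀ x : ℤ × ℤ, x ∈ WsetArg α → x ∈ S → A < znorm x →
      0 ≤ ∑' y : ℤ × ℤ, p x y *
        ((WsetArg α).indicator (fw w) (x + y) ^ γ -
          (WsetArg α).indicator (fw w) x ^ γ) := by
  have hw0 : 0 < w := by rw [hw]; positivity
  have hwα : w * α = Real.pi / 2 := by rw [hw]; field_simp
  obtain ⟨F, hF⟩ := exists_finset_jump_support hA2
  obtain ⟨c, K, δ₁, hc, hK, hδ₁, hpow⟩ := exists_posPart_branch_rpow_lower_bound w hγ
  obtain ⟨δ₂, hδ₂, hdom⟩ := exists_posPart_branch_le_indicator_fw hα0 hαπ hw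
  set T : ℝ := ‖(w * (w - 1) / 2 : ℂ)‖ with hT
  have hT0 : 0 ≤ T := norm_nonneg _
  set D := γ * w + 4 * γ * T + 2 * c * w ^ 2 with hD
  have hD0 : 0 < D := by positivity
  set ε := c * w ^ 2 * σ2 / (2 * D) with hε
  have hε0 : 0 < ε := by positivity
  have hεD : ε * D = c * w ^ 2 * σ2 / 2 := by rw [hε]; field_simp
  obtain ⟨r₁, hr₁⟩ := hsub2 ε hε0
  set R := 2 * K * b ^ 3 / (c * w ^ 2 * σ2) with hR
  refine ⟨max 1 (max r₁ (max R (max (b / δ₁) (b / δ₂)))), by positivity, fun x hx hxS hA => ?_⟩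
  simp only [max_lt_iff, div_lt_iff₀ hδ₁, div_lt_iff₀ hδ₂] at hA
  obtain ⟨hr1, hrr, hrR, hrδ₁, hrδ₂⟩ := hA
  obtain ⟨hμ, h11, h22, h12⟩ := hr₁ x hxS hrr.le
  set r := znorm x with hr
  have hr0 : 0 < r := one_pos.trans hr1
  set X := toComplex x
  have hXr : ‖X‖ = r := norm_toComplex x
  have hX : X ≠ 0 := norm_pos_iff.1 (hXr ▸ hr0)
  set a := Complex.exp ((w * ang x : ℝ) * Complex.I) with ha
  have ha1 : ‖a‖ = 1 := Complex.norm_exp_ofReal_mul_I _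
  have hare : a.re = Real.cos (w * ang x) := Complex.exp_ofReal_mul_I_re _
  have hapos : 0 < a.re := by
    obtain ⟨-, h1, h2⟩ := hx
    rw [hare]
    exact Real.cos_pos_of_mem_Ioo ⟨by nlinarith, by nlinarith⟩
  set q := a * w / X with hq
  set s := a * (w * (w - 1) / 2) / X ^ 2 with hs
  have hqn : ‖q‖ = w / r := by
    rw [hq, norm_div, norm_mul, ha1, hXr, Complex.norm_real, Real.norm_of_nonneg hw0.le, one_mul]
  have hsn : ‖s‖ = T / r ^ 2 := by
    rw [hs, norm_div, norm_mul, ha1, norm_pow, hXr, one_mul]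
  set B := (r ^ w) ^ γ * a.re ^ (γ - 1) with hB
  have hB0 : 0 ≤ B := by positivity
  have hpoint : ∀ y, p x y * (B * (γ * ((q * toComplex y).re + (s * toComplex y ^ 2).re) +
      c * (q * toComplex y).re ^ 2 - K * (b / r) ^ 3)) ≤
      p x y * ((WsetArg α).indicator (fw w) (x + y) ^ γ -
        (WsetArg α).indicator (fw w) x ^ γ) := by
    intro y
    rcases lt_or_ge b (znorm y) with hy | hy
    · rw [hA2 x y hy, zero_mul, zero_mul]
    refine mul_le_mul_of_nonneg_left ?_ (hpmf.1 x y)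
    set z := toComplex y / X with hz
    have hzn : ‖z‖ = znorm y / r := by rw [hz, norm_div, norm_toComplex, hXr]
    have hzb : ‖z‖ ≤ b / r := by rw [hzn]; gcongr
    have h1 := hpow a z ha1 hapos (hzb.trans_lt (by rw [div_lt_iff₀ hr0]; linarith))
    have h2 := hdom x y hx (hzb.trans_lt (by rw [div_lt_iff₀ hr0]; linarith))
    have e1 : a * (w * z) = q * toComplex y := by rw [hz, hq]; ring
    have e2 : a * (w * (w - 1) / 2 * z ^ 2) = s * toComplex y ^ 2 := by rw [hz, hs]; ring
    rw [e1, e2] at h1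
    have h3 := Real.rpow_le_rpow (mul_nonneg (by positivity) (le_max_right _ _)) h2
      (zero_le_one.trans hγ.le)
    rw [Real.mul_rpow (by positivity) (le_max_right _ _)] at h3
    have h4 : (WsetArg α).indicator (fw w) x ^ γ = (r ^ w) ^ γ * a.re ^ γ := by
      rw [Set.indicator_of_mem hx, fw, ← hare, Real.mul_rpow (by positivity) hapos.le]
    have h5 : K * ‖z‖ ^ 3 ≤ K * (b / r) ^ 3 := by gcongr
    rw [h4, hB, le_sub_iff_add_le, mul_assoc, ← mul_add]
    refine le_trans ?_ h3
    refine mul_le_mul_of_nonneg_left ?_ (by positivity)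
    refine le_trans ?_ h1
    rw [add_comm]
    gcongr
  rw [tsum_jump_eq_sum hF]
  refine le_trans ?_ (Finset.sum_le_sum fun y _ => hpoint y)
  have hsum1 : ∑ y ∈ F, p x y = 1 := by
    rw [← (hpmf.2 x).tsum_eq]
    exact (tsum_eq_sum fun y hy => hF x y hy).symm
  have hlin : ∑ y ∈ F, p x y * (B * (γ * ((q * toComplex y).re + (s * toComplex y ^ 2).re) +
      c * (q * toComplex y).re ^ 2 - K * (b / r) ^ 3)) =
      B * (γ * (∑ y ∈ F, p x y * (q * toComplex y).re + ∑ y ∈ F, p x y * (s * toComplex y ^ 2).re) +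
        c * ∑ y ∈ F, p x y * (q * toComplex y).re ^ 2 - (∑ y ∈ F, p x y) * (K * (b / r) ^ 3)) := by
    rw [Finset.sum_mul]
    simp only [Finset.mul_sum, ← Finset.sum_sub_distrib, ← Finset.sum_add_distrib]
    exact Finset.sum_congr rfl fun y _ => by ring
  rw [hlin, hsum1, one_mul]
  refine mul_nonneg hB0 ?_
  have hS1 := (abs_le.1 (abs_sum_re_mul_le hF x q)).1
  have hS2 := (abs_le.1 (abs_sum_re_mul_sq_le hF x s)).1
  have hS3 := le_sum_re_mul_sq hF h11 h22 h12 q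
  rw [hqn] at hS1 hS3
  rw [hsn] at hS2
  have hμ' : w / r * muNorm p x ≤ w * ε / r ^ 2 := by
    rw [div_mul_eq_mul_div, div_le_div_iff₀ hr0 (by positivity)]
    linarith [mul_le_mul_of_nonneg_left hμ (mul_pos hw0 hr0).le]
  have hM : |M11 p x - M22 p x| + 2 * |M12 p x| ≤ 4 * ε := by
    have : |M11 p x - M22 p x| ≤ 2 * ε := by
      rw [abs_le] at h11 h22 ⊢
      constructor <;> linarith
    linarith
  have hM' := mul_le_mul_of_nonneg_left hM (div_nonneg hT0 (sq_nonneg r))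
  have hRK : K * (b / r) ^ 3 ≤ c * w ^ 2 * σ2 / 2 / r ^ 2 := by
    rw [hR, div_lt_iff₀ (by positivity)] at hrR
    rw [div_pow, ← mul_div_assoc, div_le_div_iff₀ (by positivity) (by positivity)]
    linarith [mul_le_mul_of_nonneg_right hrR.le (sq_nonneg r)]
  calc (0 : ℝ) = γ * (-(w * ε / r ^ 2) + -(T / r ^ 2 * (4 * ε))) +
        c * ((w / r) ^ 2 * (σ2 - 2 * ε)) - c * w ^ 2 * σ2 / 2 / r ^ 2 := by
        have : c * w ^ 2 * σ2 = 2 * (ε * D) := by linarith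
        field_simp
        rw [hD] at this
        linarith
    _ ≤ _ := by
        gcongr
        · linarith
        · linarith
end
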